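/- arXiv:1203.4581 — 2 statements merged into one kernel-verified Lean document; each statement's English description precedes it below -/
import Mathlib

section
/- Let k, n ≥ 1 be natural numbers and X a metric space. Then the following are equivalent: (i) ∂Δ^k-Ind X < n; (ii) |∂Δ^k|-dim X < n; (iii) dim X < kn, where dim denotes the Lebesgue covering dimension. -/
open Set Topology Cardinal

noncomputable section

attribute [local instance] Classical.propDecidable

/-- Values of dimension functions: `⊥ : WithBot Ordinal.{0}` encodes `−1`,
ordinals are the usual values, and `⊤` encodes `∞`. -/
abbrev Dim : Type 1 := WithTop (WithBot Ordinal.{0})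

/-- An ordinal viewed as a dimension value. -/
def Dim.ofOrdinal (a : Ordinal.{0}) : Dim := ((a : WithBot Ordinal.{0}) : Dim)

/-- The dimension value `−1`. -/
def Dim.minusOne : Dim := ((⊥ : WithBot Ordinal.{0}) : Dim)

/-- An integer `m ≥ −1` viewed as a dimension value. -/
def Dim.ofInt (m : ℤ) : Dim := if 0 ≤ m then Dim.ofOrdinal m.toNat else Dim.minusOne

/-- `A` is a `K`-tuple for the simplicial complex `K` on the vertex set `Fin m`:
whenever the members indexed by a nonempty `I` have a common point, `I` spans a
simplex of `K`. -/
def IsKTuple {m : ℕ} (K : Finset (Fin m) → Prop) {X : Type} (A : Fin m → Set X) : Prop :=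
  ∀ I : Finset (Fin m), I.Nonempty → (⋂ i ∈ I, A i).Nonempty → K I

/-- `K` is an abstract (finite) simplicial complex with vertex set `Fin m`:
it is closed under passing to nonempty subsets, and contains every vertex. -/
def IsComplex {m : ℕ} (K : Finset (Fin m) → Prop) : Prop :=
  (∀ s t : Finset (Fin m), s ⊆ t → s.Nonempty → K t → K s) ∧ ∀ i, K {i}

/-- The boundary complex `∂Δ^k` of the `k`-simplex: all proper subsets of the
`k+1` vertices span simplices. -/
def bComplex (k : ℕ) : Finset (Fin (k + 1)) → Prop := fun s => s ≠ Finset.univ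

/-- `U` is an (open) `K`-neighbourhood of the tuple `F`. -/
def KNbhd {m : ℕ} (K : Finset (Fin m) → Prop) {X : Type} [TopologicalSpace X]
    (F U : Fin m → Set X) : Prop :=
  (∀ i, IsOpen (U i)) ∧ IsKTuple K U ∧ ∀ i, F i ⊆ U i

/-- Auxiliary form of `K-Ind X ≤ α`, defined by transfinite recursion on `α`:
every closed `K`-tuple has a `K`-neighbourhood whose corresponding `K`-partition
is either empty (dimension `−1`) or has `K-Ind < α`. -/
def KIndLeAux {m : ℕ} (K : Finset (Fin m) → Prop) :
    Ordinal.{0} → ∀ X : Type, TopologicalSpace X → Prop :=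
  (wellFounded_lt (α := Ordinal.{0})).fix fun α rec X tX =>
    letI := tX
    ∀ F : Fin m → Set X, (∀ i, IsClosed (F i)) → IsKTuple K F →
      ∃ U : Fin m → Set X, (∀ i, IsOpen (U i)) ∧ IsKTuple K U ∧ (∀ i, F i ⊆ U i) ∧
        ((⋃ i, U i)ᶜ = (∅ : Set X) ∨
          ∃ β : Set.Iio α, rec β.1 β.2 (↥((⋃ i, U i)ᶜ)) inferInstance)

/-- `K-Ind X ≤ α` (for an ordinal `α ≥ 0`). -/
def KIndLE {m : ℕ} (K : Finset (Fin m) → Prop) (X : Type) [tX : TopologicalSpace X]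
    (α : Ordinal.{0}) : Prop :=
  KIndLeAux K α X tX

/-- Fedorchuk's inductive dimension `K-Ind` modulo a simplicial complex `K`;
`−1` for the empty space, the least `α` with `K-Ind X ≤ α` otherwise, `∞` if none. -/
def KInd {m : ℕ} (K : Finset (Fin m) → Prop) (X : Type) [TopologicalSpace X] : Dim :=
  if IsEmpty X then Dim.minusOne
  else if ∃ α, KIndLE K X α then Dim.ofOrdinal (sInf {α | KIndLE K X α}) else ⊤

/-- The set of `K`-obstruction points of an open `K`-tuple `U`: points covered
by no `K`-neighbourhood of `U`. -/
def KObs {m : ℕ} (K : Finset (Fin m) → Prop) {X : Type} [TopologicalSpace X]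
    (U : Fin m → Set X) : Set X :=
  {x | ¬ ∃ V : Fin m → Set X, KNbhd K U V ∧ x ∈ ⋃ i, V i}

/-- `X` is strongly `α`-dimensional: `K-Ind X` is a positive ordinal `α` and some
closed `K`-tuple admits no `K`-neighbourhood `U` without obstruction points whose
corresponding `K`-partition has `K-Ind < α`. -/
def KStrongly {m : ℕ} (K : Finset (Fin m) → Prop) (X : Type) [TopologicalSpace X] : Prop :=
  (∃ α : Ordinal.{0}, 0 < α ∧ KInd K X = Dim.ofOrdinal α) ∧
  ∃ F : Fin m → Set X, (∀ i, IsClosed (F i)) ∧ IsKTuple K F ∧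
    ∀ U : Fin m → Set X, KNbhd K F U →
      KInd K (↥((⋃ i, U i)ᶜ)) < KInd K X → KObs K U ≠ ∅

/-- The dimensional strength degree `K-str X ∈ {0,1}`. -/
def KStr {m : ℕ} (K : Finset (Fin m) → Prop) (X : Type) [TopologicalSpace X] : ℕ :=
  if KStrongly K X then 1 else 0

/-- `K-dim X ≤ n`: any `n+1` closed `K`-tuples admit `K`-partitions with empty
intersection. -/
def KDimLE {m : ℕ} (K : Finset (Fin m) → Prop) (X : Type) [TopologicalSpace X] (n : ℕ) : Prop :=
  ∀ F : Fin (n + 1) → Fin m → Set X,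
    (∀ j i, IsClosed (F j i)) → (∀ j, IsKTuple K (F j)) →
    ∃ U : Fin (n + 1) → Fin m → Set X, (∀ j, KNbhd K (F j) (U j)) ∧
      (⋂ j, (⋃ i, U j i)ᶜ) = (∅ : Set X)

/-- Fedorchuk's dimension `K-dim` modulo a simplicial complex `K`. -/
def KDim {m : ℕ} (K : Finset (Fin m) → Prop) (X : Type) [TopologicalSpace X] : Dim :=
  if IsEmpty X then Dim.minusOne
  else if ∃ n, KDimLE K X n then Dim.ofOrdinal ((sInf {n | KDimLE K X n} : ℕ) : Ordinal.{0}) else ⊤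

/-- `dim X ≤ n` for the Lebesgue covering dimension: every finite open cover has
an open shrinking of order at most `n+1`. -/
def CovDimLE (X : Type) [TopologicalSpace X] (n : ℕ) : Prop :=
  ∀ (ι : Type), Finite ι → ∀ U : ι → Set X, (∀ i, IsOpen (U i)) → (⋃ i, U i) = Set.univ →
    ∃ V : ι → Set X, (∀ i, IsOpen (V i)) ∧ (∀ i, V i ⊆ U i) ∧ (⋃ i, V i) = Set.univ ∧
      ∀ x : X, ({i | x ∈ V i}).ncard ≤ n + 1

/-- The Lebesgue covering dimension. -/
def covDim (X : Type) [TopologicalSpace X] : Dim :=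
  if IsEmpty X then Dim.minusOne
  else if ∃ n, CovDimLE X n then Dim.ofOrdinal ((sInf {n | CovDimLE X n} : ℕ) : Ordinal.{0}) else ⊤

/-- `Ind X ≤ n` for the large inductive dimension, by recursion on `n`. -/
def IndLE : ℕ → ∀ X : Type, TopologicalSpace X → Prop
  | 0, X, tX =>
    letI := tX
    ∀ F U : Set X, IsClosed F → IsOpen U → F ⊆ U →
      ∃ V : Set X, IsOpen V ∧ F ⊆ V ∧ V ⊆ U ∧ frontier V = ∅
  | n + 1, X, tX =>
    letI := tX
    ∀ F U : Set X, IsClosed F → IsOpen U → F ⊆ U →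
      ∃ V : Set X, IsOpen V ∧ F ⊆ V ∧ V ⊆ U ∧ IndLE n (↥(frontier V)) inferInstance

/-- The large inductive dimension `Ind`. -/
def IndDim (X : Type) [tX : TopologicalSpace X] : Dim :=
  if IsEmpty X then Dim.minusOne
  else if ∃ n, IndLE n X tX then Dim.ofOrdinal ((sInf {n | IndLE n X tX} : ℕ) : Ordinal.{0}) else ⊤

/-- The relation generating the topological join `A ∗ B`: the copy of `B` is
collapsed at parameter `0`, the copy of `A` at parameter `1`. -/
def JoinRel (A B : Type) : (A × B × unitInterval) → (A × B × unitInterval) → Prop :=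
  fun p q => (p.2.2 = 0 ∧ q.2.2 = 0 ∧ p.1 = q.1) ∨ (p.2.2 = 1 ∧ q.2.2 = 1 ∧ p.2.1 = q.2.1)

/-- The topological join `A ∗ B`. -/
abbrev Join (A B : Type) [TopologicalSpace A] [TopologicalSpace B] : Type :=
  Quot (JoinRel A B)

/-- Auxiliary construction of the join of `n+1` copies of `L`, bundled with its
topology. -/
def JoinPowAux (L : Type) (tL : TopologicalSpace L) : ℕ → (T : Type) × TopologicalSpace T
  | 0 => ⟨L, tL⟩
  | n + 1 =>
    let p := JoinPowAux L tL n
    letI := tL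
    letI := p.2
    ⟨Join L p.1, inferInstance⟩

/-- The join `L ∗ ⋯ ∗ L` of `n+1` copies of `L`. -/
def JoinPow (L : Type) [tL : TopologicalSpace L] (n : ℕ) : Type :=
  (JoinPowAux L tL n).1

instance joinPowTopologicalSpace (L : Type) [tL : TopologicalSpace L] (n : ℕ) :
    TopologicalSpace (JoinPow L n) :=
  (JoinPowAux L tL n).2

/-- `L-dim X ≤ n`: every continuous map from a closed subset of `X` to the join
of `n+1` copies of `L` extends continuously over `X`. -/
def LDimLE (L : Type) [TopologicalSpace L] (X : Type) [TopologicalSpace X] (n : ℕ) : Prop :=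
  ∀ F : Set X, IsClosed F → ∀ f : C(F, JoinPow L n),
    ∃ g : C(X, JoinPow L n), ∀ x : F, g x = f x

/-- Fedorchuk's dimension `L-dim` modulo an ANR `L`. -/
def LDim (L : Type) [TopologicalSpace L] (X : Type) [TopologicalSpace X] : Dim :=
  if IsEmpty X then Dim.minusOne
  else if ∃ n, LDimLE L X n then Dim.ofOrdinal ((sInf {n | LDimLE L X n} : ℕ) : Ordinal.{0}) else ⊤

/-- Auxiliary form of `L-Ind X ≤ α`, by transfinite recursion on `α`: every map
to `L` from a closed subset of `X` has an `L`-partition which is either empty or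
has `L-Ind < α`. -/
def LIndLeAux (L : Type) [TopologicalSpace L] :
    Ordinal.{0} → ∀ X : Type, TopologicalSpace X → Prop :=
  (wellFounded_lt (α := Ordinal.{0})).fix fun α rec X tX =>
    letI := tX
    ∀ F : Set X, IsClosed F → ∀ f : C(F, L),
      ∃ U : Set X, IsOpen U ∧ ∃ hFU : F ⊆ U,
        (∃ g : C(U, L), ∀ (x : X) (hx : x ∈ F), g ⟨x, hFU hx⟩ = f ⟨x, hx⟩) ∧
        (Uᶜ = (∅ : Set X) ∨ ∃ β : Set.Iio α, rec β.1 β.2 (↥(Uᶜ)) inferInstance)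

/-- `L-Ind X ≤ α` (for an ordinal `α ≥ 0`). -/
def LIndLE (L : Type) [TopologicalSpace L] (X : Type) [tX : TopologicalSpace X]
    (α : Ordinal.{0}) : Prop :=
  LIndLeAux L α X tX

/-- Fedorchuk's inductive dimension `L-Ind` modulo an ANR `L`. -/
def LInd (L : Type) [TopologicalSpace L] (X : Type) [TopologicalSpace X] : Dim :=
  if IsEmpty X then Dim.minusOne
  else if ∃ α, LIndLE L X α then Dim.ofOrdinal (sInf {α | LIndLE L X α}) else ⊤

/-- `L` is an absolute neighbourhood retract (for metric spaces): `L` is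
metrizable and whenever a closed subset `A` of a metric space is homeomorphic to
`L` via `e`, the map `e` extends continuously over a neighbourhood of `A`. -/
def IsANR (L : Type) [TopologicalSpace L] : Prop :=
  TopologicalSpace.MetrizableSpace L ∧
  ∀ (M : Type) [MetricSpace M], ∀ A : Set M, IsClosed A → ∀ e : A ≃ₜ L,
    ∃ U : Set M, IsOpen U ∧ ∃ hAU : A ⊆ U, ∃ r : C(U, L),
      ∀ (a : M) (ha : a ∈ A), r ⟨a, hAU ha⟩ = e ⟨a, ha⟩

/-- `L-Ind_{b+} X`: the least dimension value `d` such that some open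
neighbourhood of `b` has closure of `L-Ind` at most `d`. -/
def LIndPlus (L : Type) [TopologicalSpace L] {X : Type} [TopologicalSpace X] (b : X) : Dim :=
  sInf {d : Dim | ∃ U : Set X, IsOpen U ∧ b ∈ U ∧ LInd L (↥(closure U)) ≤ d}

/-- The set `K(X) = {b ∈ X : L-Ind_{b+} X = L-Ind X}`. -/
def LKset (L : Type) [TopologicalSpace L] (X : Type) [TopologicalSpace X] : Set X :=
  {b | LIndPlus L b = LInd L X}

/-- The weight of a topological space: the least cardinality of a basis. -/
def tWeight (X : Type) [TopologicalSpace X] : Cardinal :=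
  sInf {c | ∃ B : Set (Set X), TopologicalSpace.IsTopologicalBasis B ∧ #B = c}

/-- The family `𝒮_X` of all subsets of `X` that are finite or homeomorphic to the
one-point compactification `A_{ℵ₀}` of a countably infinite discrete space. -/
def SFam (X : Type) [TopologicalSpace X] : Set (Set X) :=
  {S | S.Finite ∨ Nonempty (↥S ≃ₜ OnePoint ℕ)}

/-- The relation generating the quotient `N` in the `Z(X,Y)` construction:
each set `{μ} × {x} × Y` is collapsed to a point. -/
def ZRel (ι X Y : Type) : (OnePoint ι × X × Y) → (OnePoint ι × X × Y) → Prop :=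
  fun p q => p.1 = OnePoint.infty ∧ q.1 = OnePoint.infty ∧ p.2.1 = q.2.1

/-- The quotient space `N` of `A_𝔪 × X × Y`. -/
abbrev ZQuot (ι X Y : Type) [TopologicalSpace ι] [TopologicalSpace X] [TopologicalSpace Y] :
    Type :=
  Quot (ZRel ι X Y)

/-- The subset `Z(X,Y) = ⋃_{α ∈ A_𝔪} H(α)` of `N`:  `H(μ) = π₁({μ} × X × Y)` and
`H(α) = π₁({α} × φ(α) × Y)` for `α ≠ μ`. -/
def ZSet (ι X Y : Type) [TopologicalSpace ι] [TopologicalSpace X] [TopologicalSpace Y]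
    (φ : ι → Set X) : Set (ZQuot ι X Y) :=
  {z | ∃ p : OnePoint ι × X × Y, Quot.mk (ZRel ι X Y) p = z ∧
        (p.1 = OnePoint.infty ∨ ∃ i : ι, p.1 = (i : OnePoint ι) ∧ p.2.1 ∈ φ i)}

/-- The space `Z(X,Y)` (for the data `ι`, `φ`), with the subspace topology. -/
abbrev ZSpace (ι X Y : Type) [TopologicalSpace ι] [TopologicalSpace X] [TopologicalSpace Y]
    (φ : ι → Set X) : Type :=
  ↥(ZSet ι X Y φ)

/-- The subset `H(μ)` of `Z(X,Y)`. -/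
def ZHmu (ι X Y : Type) [TopologicalSpace ι] [TopologicalSpace X] [TopologicalSpace Y]
    (φ : ι → Set X) : Set (ZSpace ι X Y φ) :=
  {z | ∃ (x : X) (y : Y), (z : ZQuot ι X Y) = Quot.mk (ZRel ι X Y) (OnePoint.infty, x, y)}

/-- The projection `π_X : N → X`, `π₁(α,x,y) ↦ x`. -/
def ZQuotProjX {ι X Y : Type} [TopologicalSpace ι] [TopologicalSpace X] [TopologicalSpace Y] :
    ZQuot ι X Y → X :=
  Quot.lift (fun p => p.2.1) (fun _ _ h => h.2.2)

/-- The projection `π_X : Z(X,Y) → X`. -/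
def ZProjX {ι X Y : Type} [TopologicalSpace ι] [TopologicalSpace X] [TopologicalSpace Y]
    (φ : ι → Set X) : ZSpace ι X Y φ → X :=
  fun z => ZQuotProjX (z : ZQuot ι X Y)

/-- The cardinality requirements on the index set `ι` (of cardinality `𝔪`) in the
`Z(X,Y)` construction: `𝔪 ≥ max {ℵ₀, (wX)⁺, (wY)⁺, card 𝒮_X}`. -/
def ZCardOK (X Y ι : Type) [TopologicalSpace X] [TopologicalSpace Y] : Prop :=
  ℵ₀ ≤ #ι ∧ tWeight X < #ι ∧ tWeight Y < #ι ∧ #(SFam X) ≤ #ι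

/-- The requirements on `φ : A_𝔪 \ {μ} → 𝒮_X`: it takes values in `𝒮_X` and every
fibre has cardinality `𝔪`. -/
def ZPhiOK {X ι : Type} [TopologicalSpace X] (φ : ι → Set X) : Prop :=
  (∀ i, φ i ∈ SFam X) ∧ ∀ S ∈ SFam X, #(↥(φ ⁻¹' {S})) = #ι

/-! ### Extension of nowhere vanishing maps -/

/-- Every nowhere vanishing partial map on a closed set extends to a nowhere vanishing map. -/
def NVExt (E : Type) [NormedAddCommGroup E] (X : Type) [TopologicalSpace X] : Prop :=
  ∀ F : Set X, IsClosed F → ∀ f : X → E, ContinuousOn f F → (∀ x ∈ F, f x ≠ 0) →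
    ∃ g : X → E, Continuous g ∧ (∀ x, g x ≠ 0) ∧ ∀ x ∈ F, g x = f x

theorem tietze_on {E : Type} [NormedAddCommGroup E] [NormedSpace ℝ E] [FiniteDimensional ℝ E]
    {X : Type} [TopologicalSpace X] [NormalSpace X] {F : Set X} (hF : IsClosed F) {f : X → E}
    (hf : ContinuousOn f F) : ∃ g : X → E, Continuous g ∧ ∀ x ∈ F, g x = f x := by
  obtain ⟨g, hg⟩ := ContinuousMap.exists_restrict_eq hF ⟨F.domRestrict f, hf.domRestrict⟩
  refine ⟨g, g.continuous, fun x hx => ?_⟩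
  have := congrArg (fun u : C(F, E) => u ⟨x, hx⟩) hg
  exact this

theorem homotopy_ext {E : Type} [NormedAddCommGroup E] [NormedSpace ℝ E] [FiniteDimensional ℝ E]
    {X : Type} [TopologicalSpace X] [NormalSpace X] {F : Set X} (hF : IsClosed F) {f h : X → E}
    (hf : ContinuousOn f F) (hh : Continuous h) (hh0 : ∀ x, h x ≠ 0)
    (hs : ∀ x ∈ F, ∀ t : ℝ, 0 ≤ t → t ≤ 1 → (1 - t) • h x + t • f x ≠ 0) :
    ∃ g : X → E, Continuous g ∧ (∀ x, g x ≠ 0) ∧ ∀ x ∈ F, g x = f x := by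
  obtain ⟨f', hf', hff⟩ := tietze_on hF hf
  set Z : Set (X × unitInterval) := {p | (1 - (p.2 : ℝ)) • h p.1 + (p.2 : ℝ) • f' p.1 = 0} with hZ
  have hZc : IsClosed Z := by
    apply isClosed_eq _ continuous_const
    fun_prop
  have hC : IsClosed (Prod.fst '' Z) := isClosedMap_fst_of_compactSpace _ hZc
  have hd : Disjoint (Prod.fst '' Z) F := by
    rw [Set.disjoint_left]
    rintro x ⟨⟨y, t⟩, hp, rfl⟩ hx
    apply hs y hx t t.2.1 t.2.2
    rw [← hff y hx]
    exact hp
  obtain ⟨l, h0, h1, h01⟩ := exists_continuous_zero_one_of_isClosed hC hF hd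
  refine ⟨fun x => (1 - l x) • h x + l x • f' x, by fun_prop, fun x hx => ?_, fun x hx => ?_⟩
  · by_cases hxc : x ∈ Prod.fst '' Z
    · have := h0 hxc
      simp only [Pi.zero_apply] at this
      simp only [this] at hx
      apply hh0 x
      simpa using hx
    · exact hxc ⟨(x, ⟨l x, h01 x⟩), hx, rfl⟩
  · have := h1 hx
    simp only [Pi.one_apply] at this
    simp [this, hff x hx]

theorem NVExt.congr {E E' : Type} [NormedAddCommGroup E] [NormedSpace ℝ E] [FiniteDimensional ℝ E]
    [NormedAddCommGroup E'] [NormedSpace ℝ E'] [FiniteDimensional ℝ E']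
    (hE : Module.finrank ℝ E = Module.finrank ℝ E') {X : Type} [TopologicalSpace X]
    (h : NVExt E X) : NVExt E' X := by
  let e : E ≃L[ℝ] E' := ContinuousLinearEquiv.ofFinrankEq hE
  intro F hF f hf hf0
  obtain ⟨g, hg, hg0, hgf⟩ := h F hF (fun x => e.symm (f x))
    (e.symm.continuous.comp_continuousOn hf) (fun x hx => by simpa using hf0 x hx)
  exact ⟨fun x => e (g x), by fun_prop, fun x => by simpa using hg0 x, fun x hx => by
    simp [hgf x hx]⟩

/-! ### Functions cutting out open sets -/

/-- A nonnegative continuous function that is positive exactly on `U`. -/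
def cutFun {X : Type} [MetricSpace X] (U : Set X) (x : X) : ℝ :=
  if U = Set.univ then 1 else Metric.infDist x Uᶜ

theorem cutFun_cont {X : Type} [MetricSpace X] (U : Set X) : Continuous (cutFun U) := by
  unfold cutFun
  by_cases h : U = Set.univ
  · simp only [h, if_true]; exact continuous_const
  · simp only [h, if_false]; exact Metric.continuous_infDist_pt _

theorem cutFun_nonneg {X : Type} [MetricSpace X] (U : Set X) (x : X) : 0 ≤ cutFun U x := by
  unfold cutFun
  split_ifs
  · exact zero_le_one
  · exact Metric.infDist_nonneg

theorem cutFun_pos {X : Type} [MetricSpace X] {U : Set X} (hU : IsOpen U) {x : X} :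
    0 < cutFun U x ↔ x ∈ U := by
  unfold cutFun
  split_ifs with h
  · simp [h]
  · rw [← hU.isClosed_compl.notMem_iff_infDist_pos (by simpa [Set.nonempty_compl] using h)]
    simp

theorem cutFun_eq_zero {X : Type} [MetricSpace X] {U : Set X} (hU : IsOpen U) {x : X} :
    cutFun U x = 0 ↔ x ∉ U := by
  rw [← cutFun_pos hU]
  constructor
  · intro h; simp [h]
  · intro h; exact le_antisymm (not_lt.1 h) (cutFun_nonneg _ _)

/-! ### Extension property implies small covers -/

/-- Finite open covers have open shrinkings of order at most `N`. -/
def CovS (X : Type) [TopologicalSpace X] (N : ℕ) : Prop :=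
  ∀ (ι : Type), Finite ι → ∀ U : ι → Set X, (∀ i, IsOpen (U i)) → (⋃ i, U i) = Set.univ →
    ∃ V : ι → Set X, (∀ i, IsOpen (V i)) ∧ (∀ i, V i ⊆ U i) ∧ (⋃ i, V i) = Set.univ ∧
      ∀ x : X, ({i | x ∈ V i}).ncard ≤ N

theorem ext_shrink {N : ℕ} {X : Type} [MetricSpace X] (h : NVExt (Fin N → ℝ) X)
    (G : Fin (N + 1) → Set X) (hG : ∀ i, IsOpen (G i)) (hc : ⋃ i, G i = Set.univ) :
    ∃ V : Fin (N + 1) → Set X, (∀ i, IsOpen (V i)) ∧ (∀ i, V i ⊆ G i) ∧ (⋃ i, V i) = Set.univ ∧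
      (⋂ i, V i) = ∅ := by
  set φ : Fin (N + 1) → X → ℝ := fun i => cutFun (G i)
  have hφc : ∀ i, Continuous (φ i) := fun i => cutFun_cont _
  set F : Set X := ⋃ i, {x | φ i x = 0}
  have hF : IsClosed F := isClosed_iUnion_of_finite fun i => isClosed_eq (hφc i) continuous_const
  obtain ⟨g, hg, hg0, hgf⟩ := h F hF (fun x i => φ i.succ x - φ 0 x) (by
    apply Continuous.continuousOn
    fun_prop) (by
    intro x hx h0
    have h1 : ∀ i, φ i x = φ 0 x := by
      intro i
      refine Fin.cases rfl (fun j => ?_) i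
      have := congrFun h0 j
      simp only [Pi.zero_apply] at this
      linarith
    obtain ⟨i, hi⟩ := mem_iUnion.1 hx
    obtain ⟨j, hj⟩ := mem_iUnion.1 (hc ▸ mem_univ x)
    have hi : φ i x = 0 := hi
    have h2 : 0 < φ j x := (cutFun_pos (hG j)).2 hj
    rw [h1] at hi h2
    linarith)
  set g' : Fin (N + 1) → X → ℝ := fun i x => Fin.cons (α := fun _ => ℝ) 0 (g x) i
  have hg' : ∀ i, Continuous (g' i) := by
    intro i
    refine Fin.cases ?_ (fun j => ?_) i
    · simp only [g', Fin.cons_zero]; exact continuous_const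
    · simp only [g', Fin.cons_succ]; fun_prop
  have hgF : ∀ x ∈ F, ∀ i, g' i x = φ i x - φ 0 x := by
    intro x hx i
    refine Fin.cases ?_ (fun j => ?_) i
    · simp [g']
    · simp [g', hgf x hx]
  refine ⟨fun i => ⋃ j, {x | g' j x < g' i x}, fun i => ?_, fun i x hx => ?_, ?_, ?_⟩
  · exact isOpen_iUnion fun j => isOpen_lt (hg' j) (hg' i)
  · by_contra hxi
    have h0 : φ i x = 0 := (cutFun_eq_zero (hG i)).2 hxi
    have hxF : x ∈ F := mem_iUnion.2 ⟨i, h0⟩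
    obtain ⟨j, hj⟩ := mem_iUnion.1 hx
    have hj : g' j x < g' i x := hj
    rw [hgF x hxF, hgF x hxF, h0] at hj
    have : 0 ≤ φ j x := cutFun_nonneg _ _
    linarith
  · rw [eq_univ_iff_forall]
    intro x
    by_contra hx
    apply hg0 x
    simp only [mem_iUnion, mem_ofPred_eq, not_exists, not_lt] at hx
    ext i
    have h1 := hx i.succ 0
    have h2 := hx 0 i.succ
    simp only [g', Fin.cons_zero, Fin.cons_succ] at h1 h2
    exact le_antisymm h1 h2
  · rw [eq_empty_iff_forall_notMem]
    intro x hx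
    obtain ⟨i, -, hi⟩ := Finset.exists_min_image Finset.univ (fun i => g' i x) ⟨0, Finset.mem_univ _⟩
    obtain ⟨j, hj⟩ := mem_iUnion.1 (mem_iInter.1 hx i)
    have hj : g' j x < g' i x := hj
    have := hi j (Finset.mem_univ _)
    linarith

/-- The reduction of Hemmingsen. -/
theorem covS_of_shrink {N : ℕ} {X : Type} [TopologicalSpace X]
    (h : ∀ G : Fin (N + 1) → Set X, (∀ i, IsOpen (G i)) → (⋃ i, G i = Set.univ) →
    ∃ V : Fin (N + 1) → Set X, (∀ i, IsOpen (V i)) ∧ (∀ i, V i ⊆ G i) ∧ (⋃ i, V i) = Set.univ ∧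
      (⋂ i, V i) = ∅) : CovS X N := by
  intro ι _ U hU hc
  have := Fintype.ofFinite ι
  -- treat a finite collection of index sets
  have key : ∀ 𝒥 : Finset (Finset ι), (∀ J ∈ 𝒥, J.card = N + 1) →
      ∃ V : ι → Set X, (∀ i, IsOpen (V i)) ∧ (∀ i, V i ⊆ U i) ∧ (⋃ i, V i) = Set.univ ∧
        ∀ J ∈ 𝒥, (⋂ i ∈ J, V i) = ∅ := by
    intro 𝒥
    induction 𝒥 using Finset.induction_on with
    | empty => intro _; exact ⟨U, hU, fun i => Subset.rfl, hc, by simp⟩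
    | insert J 𝒥 hJ ih =>
      intro hcard
      obtain ⟨V, hV, hVU, hVc, hVJ⟩ := ih fun J' hJ' => hcard J' (Finset.mem_insert_of_mem hJ')
      have hJc : J.card = N + 1 := hcard J (Finset.mem_insert_self _ _)
      let e : Fin (N + 1) ≃ J := (Finset.equivFinOfCardEq hJc).symm
      let G : Fin (N + 1) → Set X := fun a => if a = 0 then V (e a) ∪ ⋃ i ∈ {i | i ∉ J}, V i
        else V (e a)
      have hGsub : ∀ a, V (e a) ⊆ G a := by
        intro a
        by_cases ha : a = 0
        · simp only [G, ha, if_true]; exact subset_union_left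
        · simp only [G, ha, if_false]; exact Subset.rfl
      obtain ⟨W, hW, hWG, hWc, hWe⟩ := h G (by
        intro a
        by_cases ha : a = 0
        · simp only [G, ha, if_true]
          exact (hV _).union (isOpen_biUnion fun i _ => hV i)
        · simp only [G, ha, if_false]; exact hV _) (by
        rw [eq_univ_iff_forall]
        intro x
        obtain ⟨i, hi⟩ := mem_iUnion.1 (hVc ▸ mem_univ x)
        by_cases hiJ : i ∈ J
        · refine mem_iUnion.2 ⟨e.symm ⟨i, hiJ⟩, hGsub _ ?_⟩
          simpa using hi
        · refine mem_iUnion.2 ⟨0, ?_⟩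
          simp only [G, if_true]
          right
          exact mem_biUnion hiJ hi)
      refine ⟨fun i => if hi : i ∈ J then V i ∩ W (e.symm ⟨i, hi⟩) else V i ∩ W 0, ?_, ?_, ?_, ?_⟩
      · intro i
        by_cases hi : i ∈ J
        · simp only [hi, dif_pos]; exact (hV i).inter (hW _)
        · simp only [hi, dif_neg, not_false_eq_true]; exact (hV i).inter (hW _)
      · intro i
        by_cases hi : i ∈ J
        · simp only [hi, dif_pos]; exact inter_subset_left.trans (hVU i)
        · simp only [hi, dif_neg, not_false_eq_true]; exact inter_subset_left.trans (hVU i)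
      · rw [eq_univ_iff_forall]
        intro x
        obtain ⟨a, ha⟩ := mem_iUnion.1 (hWc ▸ mem_univ x)
        have hx := hWG a ha
        have hmain : x ∈ V (e a) → x ∈ ⋃ i, (if hi : i ∈ J then V i ∩ W (e.symm ⟨i, hi⟩)
            else V i ∩ W 0) := by
          intro hxa
          refine mem_iUnion.2 ⟨e a, ?_⟩
          simp only [(e a).2, dif_pos, Subtype.coe_eta, Equiv.symm_apply_apply]
          exact ⟨hxa, ha⟩
        by_cases h0 : a = 0
        · subst h0
          simp only [G, if_true] at hx
          rcases hx with hx | hx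
          · exact hmain hx
          · obtain ⟨i, hi, hxi⟩ := mem_iUnion₂.1 hx
            refine mem_iUnion.2 ⟨i, ?_⟩
            have hi : i ∉ J := hi
            simp only [hi, dif_neg, not_false_eq_true]
            exact ⟨hxi, ha⟩
        · simp only [G, h0, if_false] at hx
          exact hmain hx
      · intro J' hJ'
        rw [eq_empty_iff_forall_notMem]
        intro x hx
        rw [mem_iInter₂] at hx
        rcases Finset.mem_insert.1 hJ' with rfl | hJ'
        · have : x ∈ ⋂ a, W a := by
            rw [mem_iInter]
            intro a
            have := hx (e a) (e a).2
            simp only [(e a).2, dif_pos, Subtype.coe_eta, Equiv.symm_apply_apply] at this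
            exact this.2
          rw [hWe] at this
          exact this
        · have : x ∈ ⋂ i ∈ J', V i := by
            rw [mem_iInter₂]
            intro i hi
            have := hx i hi
            by_cases hiJ : i ∈ J
            · simp only [hiJ, dif_pos] at this; exact this.1
            · simp only [hiJ, dif_neg, not_false_eq_true] at this; exact this.1
          rw [hVJ J' hJ'] at this
          exact this
  obtain ⟨V, hV, hVU, hVc, hVJ⟩ := key (Finset.powersetCard (N + 1) Finset.univ) (fun J hJ =>
    (Finset.mem_powersetCard.1 hJ).2)
  refine ⟨V, hV, hVU, hVc, fun x => ?_⟩
  by_contra hx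
  rw [not_le] at hx
  rw [Set.ncard_eq_toFinset_card'] at hx
  obtain ⟨J, hJs, hJc⟩ := Finset.exists_subset_card_eq hx
  have : x ∈ ⋂ i ∈ J, V i := by
    rw [mem_iInter₂]
    intro i hi
    simpa using hJs hi
  rw [hVJ J (Finset.mem_powersetCard.2 ⟨Finset.subset_univ _, hJc⟩)] at this
  exact this

theorem NVExt.covS {N : ℕ} {X : Type} [MetricSpace X] (h : NVExt (Fin N → ℝ) X) : CovS X N :=
  covS_of_shrink fun G hG hc => ext_shrink h G hG hc

theorem exists_generic {E : Type} [NormedAddCommGroup E] [NormedSpace ℝ E] [FiniteDimensional ℝ E]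
    {ι : Type} [Fintype ι] (p : ι → E) {δ : ℝ} (hδ : 0 < δ) :
    ∃ z : E, ‖z‖ < δ ∧ ∀ s : Finset ι, s.Nonempty → s.card ≤ Module.finrank ℝ E →
      z ∉ affineSpan ℝ (p '' (s : Set ι)) := by
  borelize E
  let μ : MeasureTheory.Measure E := MeasureTheory.Measure.addHaar
  let S : Set (Finset ι) := {s | s.Nonempty ∧ s.card ≤ Module.finrank ℝ E}
  have h0 : μ (⋃ s ∈ S, (affineSpan ℝ (p '' (s : Set ι)) : Set E)) = 0 := by
    rw [MeasureTheory.measure_biUnion_null_iff (Set.to_countable S)]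
    rintro s ⟨hs, hsc⟩
    apply MeasureTheory.Measure.addHaar_affineSubspace
    intro htop
    have h1 := congrArg AffineSubspace.direction htop
    rw [direction_affineSpan, AffineSubspace.direction_top] at h1
    obtain ⟨m, hm⟩ : ∃ m, s.card = m + 1 := ⟨s.card - 1, by have := hs.card_pos; omega⟩
    have h2 := finrank_vectorSpan_image_finset_le ℝ p s hm
    rw [Finset.coe_image, h1, finrank_top] at h2
    omega
  have hpos : 0 < μ (Metric.ball (0 : E) δ) := Metric.measure_ball_pos _ _ hδ
  by_contra hcon
  push Not at hcon
  have : Metric.ball (0 : E) δ ⊆ ⋃ s ∈ S, (affineSpan ℝ (p '' (s : Set ι)) : Set E) := by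
    intro z hz
    obtain ⟨s, hs, hsc, hzs⟩ := hcon z (by simpa using hz)
    exact mem_biUnion (show s ∈ S from ⟨hs, hsc⟩) hzs
  have := MeasureTheory.measure_mono (μ := μ) this
  rw [h0] at this
  exact absurd hpos (not_lt.2 this)

theorem CovS.nvExt {E : Type} [NormedAddCommGroup E] [NormedSpace ℝ E] [FiniteDimensional ℝ E]
    {X : Type} [MetricSpace X] (h : CovS X (Module.finrank ℝ E)) : NVExt E X := by
  intro F hF f hf hf0
  have hfn : ContinuousOn (fun x => (‖f x‖)⁻¹ • f x) F := by
    apply ContinuousOn.smul _ hf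
    exact ContinuousOn.inv₀ hf.norm fun x hx => norm_ne_zero_iff.2 (hf0 x hx)
  obtain ⟨g0, hg0, hgf0⟩ := tietze_on hF hfn
  let g : X → E := fun x => (max 1 ‖g0 x‖)⁻¹ • g0 x
  have hg : Continuous g := by
    apply Continuous.smul _ hg0
    apply Continuous.inv₀ (by fun_prop)
    intro x
    have : (1:ℝ) ≤ max 1 ‖g0 x‖ := le_max_left _ _
    positivity
  have hg1 : ∀ x, ‖g x‖ ≤ 1 := by
    intro x
    have h1 : (1:ℝ) ≤ max 1 ‖g0 x‖ := le_max_left _ _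
    have h2 : ‖g0 x‖ ≤ max 1 ‖g0 x‖ := le_max_right _ _
    simp only [g, norm_smul, norm_inv, Real.norm_eq_abs]
    rw [abs_of_pos (by linarith), inv_mul_le_iff₀ (by linarith)]
    simpa using h2
  have hgF : ∀ x ∈ F, g x = (‖f x‖)⁻¹ • f x := by
    intro x hx
    have hn : ‖f x‖ ≠ 0 := norm_ne_zero_iff.2 (hf0 x hx)
    simp only [g, hgf0 x hx, norm_smul, norm_inv, norm_norm]
    rw [inv_mul_cancel₀ hn]; simp
  obtain ⟨t, -, htf, htc⟩ := (isCompact_closedBall (0 : E) 1).finite_cover_balls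
    (e := 1/4) (by norm_num)
  have := htf.fintype
  obtain ⟨V, hV, hVU, hVc, hVn⟩ := h t inferInstance (fun y => g ⁻¹' (Metric.ball y (1/4)))
    (fun y => Metric.isOpen_ball.preimage hg) (by
      rw [eq_univ_iff_forall]
      intro x
      have : g x ∈ Metric.closedBall (0 : E) 1 := by simpa using hg1 x
      obtain ⟨y, hy, hxy⟩ := mem_iUnion₂.1 (htc this)
      exact mem_iUnion.2 ⟨⟨y, hy⟩, hxy⟩)
  obtain ⟨ρ, hρ⟩ := PartitionOfUnity.exists_isSubordinate (s := Set.univ) isClosed_univ V hV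
    (by rw [hVc])
  obtain ⟨z, hz, hzs⟩ := exists_generic (fun y : t => (y : E)) (δ := 1/4) (by norm_num)
  let h0 : X → E := fun x => ∑ y : t, ρ y x • (y : E)
  have hh0 : Continuous h0 := by
    apply continuous_finsetSum
    intro i _
    exact ((ρ i).continuous).smul continuous_const
  have hsum : ∀ x, ∃ s : Finset t, (∀ i ∈ s, x ∈ V i) ∧ (∑ i ∈ s, ρ i x = 1) ∧
      h0 x = ∑ i ∈ s, ρ i x • (i : E) := by
    intro x
    refine ⟨Finset.univ.filter fun i => ρ i x ≠ 0, ?_, ?_, ?_⟩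
    · intro i hi
      have : ρ i x ≠ 0 := by simpa using hi
      exact hρ i (subset_tsupport _ this)
    · have := ρ.sum_eq_one (mem_univ x)
      rw [finsum_eq_sum_of_fintype] at this
      rw [Finset.sum_filter_ne_zero]; exact this
    · simp only [h0]
      rw [Finset.sum_filter_of_ne]
      intro i _ hi h'
      rw [h', zero_smul] at hi
      exact hi rfl
  have hnear : ∀ x, ‖h0 x - g x‖ ≤ 1/4 := by
    intro x
    obtain ⟨s, hs, hs1, hsx⟩ := hsum x
    have := (convex_closedBall (g x) (1/4)).sum_mem (t := s) (w := fun i => ρ i x)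
      (z := fun i : t => (i : E)) (fun i _ => ρ.nonneg i x) hs1 (by
        intro i hi
        have := hVU i (hs i hi)
        have : g x ∈ Metric.ball (i : E) (1/4) := this
        rw [Metric.mem_ball, dist_comm] at this
        exact this.le)
    rw [← hsx, Metric.mem_closedBall, dist_eq_norm] at this
    exact this
  refine homotopy_ext hF (h := fun x => h0 x - z) hf (by fun_prop) ?_ ?_
  · intro x hx
    obtain ⟨s, hs, hs1, hsx⟩ := hsum x
    apply hzs s
    · rw [Finset.nonempty_iff_ne_empty]
      rintro rfl
      simp at hs1
    · refine le_trans ?_ (hVn x)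
      rw [Set.ncard_eq_toFinset_card']
      apply Finset.card_le_card
      intro i hi
      simpa using hs i hi
    · have := (AffineSubspace.convex (affineSpan ℝ ((fun y : t => (y : E)) '' (s : Set t)))).sum_mem
        (t := s) (w := fun i => ρ i x)
        (z := fun i : t => (i : E)) (fun i _ => ρ.nonneg i x) hs1 (by
          intro i hi
          exact subset_affineSpan ℝ _ ⟨i, hi, rfl⟩)
      rw [← hsx] at this
      rw [sub_eq_zero] at hx
      rw [← hx]
      exact this
  · intro x hx r hr0 hr1 hzero
    have hn : 0 < ‖f x‖ := norm_pos_iff.2 (hf0 x hx)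
    obtain ⟨u, hu⟩ : ∃ u, u = g x := ⟨_, rfl⟩
    have hfu : f x = ‖f x‖ • u := by
      rw [hu, hgF x hx, smul_smul, mul_inv_cancel₀ hn.ne', one_smul]
    have hu1 : ‖u‖ = 1 := by
      rw [hu, hgF x hx, norm_smul, norm_inv, norm_norm, inv_mul_cancel₀ hn.ne']
    have hd : ‖h0 x - z - u‖ ≤ 1/2 := by
      have h1 : h0 x - z - u = (h0 x - u) - z := by abel
      rw [h1]
      have := norm_sub_le (h0 x - u) z
      have := hnear x
      rw [← hu] at this
      linarith
    have he : ((1 - r) + r * ‖f x‖) • u = -((1 - r) • (h0 x - z - u)) := by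
      rw [hfu] at hzero
      have : ((1 - r) + r * ‖f x‖) • u + ((1 - r) • (h0 x - z - u)) = 0 := by
        rw [← hzero]
        module
      exact eq_neg_of_add_eq_zero_left this
    have hc : 0 ≤ (1 - r) + r * ‖f x‖ := by
      have : 0 ≤ r * ‖f x‖ := by positivity
      linarith
    have he' := congrArg norm he
    rw [norm_neg, norm_smul _ u, norm_smul, hu1, mul_one, Real.norm_eq_abs, Real.norm_eq_abs,
      abs_of_nonneg hc, abs_of_nonneg (by linarith)] at he'
    have h3 : (1 - r) * ‖h0 x - z - u‖ ≤ (1 - r) * (1/2) :=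
      mul_le_mul_of_nonneg_left hd (by linarith)
    rcases eq_or_lt_of_le hr0 with h | h
    · subst h; linarith
    · have : 0 < r * ‖f x‖ := by positivity
      nlinarith

/-- The inductive step: partitions of tuples give extensions of nowhere vanishing maps. -/
theorem nvExt_prod {k : ℕ} {E : Type} [NormedAddCommGroup E] [NormedSpace ℝ E]
    [FiniteDimensional ℝ E] {X : Type} [MetricSpace X]
    (h : ∀ F : Fin (k + 1) → Set X, (∀ i, IsClosed (F i)) → (⋂ i, F i) = ∅ →
      ∃ U : Fin (k + 1) → Set X, (∀ i, IsOpen (U i)) ∧ (⋂ i, U i) = ∅ ∧ (∀ i, F i ⊆ U i) ∧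
        NVExt E (↥((⋃ i, U i)ᶜ))) : NVExt ((Fin k → ℝ) × E) X := by
  intro F hF f hf hf0
  obtain ⟨f', hf', hff⟩ := tietze_on hF hf
  set A : Set X := F ∩ {x | ‖(f' x).2‖ ≤ ‖(f' x).1‖} with hA
  set B : Set X := F ∩ {x | ‖(f' x).1‖ ≤ ‖(f' x).2‖} with hB
  have hAc : IsClosed A := hF.inter (isClosed_le (by fun_prop) (by fun_prop))
  have hBc : IsClosed B := hF.inter (isClosed_le (by fun_prop) (by fun_prop))
  have hAB : ∀ x ∈ F, x ∈ A ∨ x ∈ B := by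
    intro x hx
    rcases le_total ‖(f' x).2‖ ‖(f' x).1‖ with h | h
    · exact Or.inl ⟨hx, h⟩
    · exact Or.inr ⟨hx, h⟩
  have hA0 : ∀ x ∈ A, (f' x).1 ≠ 0 := by
    rintro x ⟨hx, hx'⟩ h0
    rw [mem_ofPred_eq, h0, norm_zero] at hx'
    apply hf0 x hx
    rw [← hff x hx]
    exact Prod.ext h0 (norm_le_zero_iff.1 hx')
  have hB0 : ∀ x ∈ B, (f' x).2 ≠ 0 := by
    rintro x ⟨hx, hx'⟩ h0
    rw [mem_ofPred_eq, h0, norm_zero] at hx'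
    apply hf0 x hx
    rw [← hff x hx]
    exact Prod.ext (norm_le_zero_iff.1 hx') h0
  set a : Fin (k + 1) → X → ℝ := fun i x => Fin.cons (α := fun _ => ℝ) 0 ((f' x).1) i
  have ha : ∀ i, Continuous (a i) := by
    intro i
    refine Fin.cases ?_ (fun j => ?_) i
    · simp only [a, Fin.cons_zero]; exact continuous_const
    · simp only [a, Fin.cons_succ]; fun_prop
  obtain ⟨U, hU, hUe, hFU, hP⟩ := h (fun i => A ∩ ⋂ j, {x | a j x ≤ a i x}) (fun i =>
    hAc.inter (isClosed_iInter fun j => isClosed_le (ha j) (ha i))) (by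
    rw [eq_empty_iff_forall_notMem]
    intro x hx
    rw [mem_iInter] at hx
    apply hA0 x (hx 0).1
    ext i
    have h1 := mem_iInter.1 (hx 0).2 i.succ
    have h2 := mem_iInter.1 (hx i.succ).2 0
    simp only [a, Fin.cons_zero, Fin.cons_succ, mem_ofPred_eq] at h1 h2
    exact le_antisymm h1 h2)
  have hAmax : ∀ x ∈ A, ∃ j, x ∈ U j ∧ ∀ i, a i x ≤ a j x := by
    intro x hx
    obtain ⟨j, -, hj⟩ := Finset.exists_max_image Finset.univ (fun i => a i x) ⟨0, Finset.mem_univ _⟩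
    exact ⟨j, hFU j ⟨hx, mem_iInter.2 fun i => hj i (Finset.mem_univ _)⟩,
      fun i => hj i (Finset.mem_univ _)⟩
  set P : Set X := (⋃ i, U i)ᶜ with hPdef
  have hPc : IsClosed P := (isOpen_iUnion hU).isClosed_compl
  have hAP : ∀ x ∈ A, x ∉ P := by
    intro x hx hxP
    obtain ⟨j, hj, -⟩ := hAmax x hx
    exact hxP (mem_iUnion.2 ⟨j, hj⟩)
  let w : X → Fin k → ℝ := fun x i => cutFun (U i.succ) x - cutFun (U 0) x
  have hw : Continuous w := by
    apply continuous_pi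
    intro i
    exact (cutFun_cont _).sub (cutFun_cont _)
  have hmiss : ∀ x, ∃ i, x ∉ U i := by
    intro x
    by_contra hcon
    push Not at hcon
    have : x ∈ ⋂ i, U i := mem_iInter.2 hcon
    rw [hUe] at this
    exact this
  have hw0 : ∀ x, x ∉ P → w x ≠ 0 := by
    intro x hx hwx
    have h1 : ∀ i, cutFun (U i) x = cutFun (U 0) x := by
      intro i
      refine Fin.cases rfl (fun j => ?_) i
      have := congrFun hwx j
      simp only [Pi.zero_apply, w] at this
      linarith
    rw [hPdef, notMem_compl_iff] at hx
    obtain ⟨j, hj⟩ := mem_iUnion.1 hx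
    obtain ⟨i, hi⟩ := hmiss x
    have h2 := (cutFun_pos (hU j)).2 hj
    have h3 := (cutFun_eq_zero (hU i)).2 hi
    rw [h1] at h2 h3
    linarith
  -- the second coordinate
  obtain ⟨g2, hg2, hg20, hg2f⟩ := hP (Subtype.val ⁻¹' B) (hBc.preimage continuous_subtype_val)
    (fun x => (f' x).2) (by apply Continuous.continuousOn; fun_prop) (fun x hx => hB0 x hx)
  let v0 : X → E := fun x => if hx : x ∈ P then g2 ⟨x, hx⟩ else (f' x).2
  have hv0B : ∀ x ∈ B, v0 x = (f' x).2 := by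
    intro x hx
    by_cases hxP : x ∈ P
    · simp only [v0, hxP, dif_pos]
      exact hg2f ⟨x, hxP⟩ hx
    · simp only [v0, hxP, dif_neg, not_false_eq_true]
  have hv0P : ContinuousOn v0 P := by
    rw [continuousOn_iff_continuous_domRestrict]
    have : P.domRestrict v0 = g2 := by
      ext x
      simp [v0]
    rw [this]
    exact hg2
  have hv0c : ContinuousOn v0 (P ∪ B) := by
    apply ContinuousOn.union_of_isClosed hv0P _ hPc hBc
    have : ContinuousOn (fun x => (f' x).2) B := by
      apply Continuous.continuousOn; fun_prop
    exact this.congr hv0B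
  obtain ⟨v, hv, hvv⟩ := tietze_on (hPc.union hBc) hv0c
  refine homotopy_ext hF (h := fun x => (w x, v x)) hf (by fun_prop) ?_ ?_
  · intro x hx
    by_cases hxP : x ∈ P
    · have h2 : v x = 0 := congrArg Prod.snd hx
      rw [hvv x (Or.inl hxP)] at h2
      simp only [v0, hxP, dif_pos] at h2
      exact hg20 _ h2
    · exact hw0 x hxP (congrArg Prod.fst hx)
  · intro x hx t ht0 ht1 hzero
    rw [← hff x hx] at hzero
    rcases hAB x hx with hxA | hxB
    · have h1 : (1 - t) • w x + t • (f' x).1 = 0 := congrArg Prod.fst hzero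
      have h2 : ∀ i, (1 - t) * (cutFun (U i) x) + t * a i x = (1 - t) * cutFun (U 0) x := by
        intro i
        refine Fin.cases ?_ (fun j => ?_) i
        · simp [a]
        · have := congrFun h1 j
          simp only [w, Pi.add_apply, Pi.smul_apply, smul_eq_mul, Pi.zero_apply] at this
          simp only [a, Fin.cons_succ]
          linarith
      obtain ⟨i, hi⟩ := hmiss x
      obtain ⟨j, hj, hjmax⟩ := hAmax x hxA
      have hai : a i x < a j x := by
        apply lt_of_le_of_ne (hjmax i)
        intro heq
        apply hi
        apply hFU i
        refine ⟨hxA, mem_iInter.2 fun l => ?_⟩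
        rw [mem_ofPred_eq, heq]
        exact hjmax l
      have h3 := (cutFun_pos (hU j)).2 hj
      have h4 := (cutFun_eq_zero (hU i)).2 hi
      have h5 := h2 i
      have h6 := h2 j
      rw [h4] at h5
      rcases eq_or_lt_of_le ht0 with h | h
      · subst h; simp at h5 h6; linarith
      · have h7 : t * a i x < t * a j x := mul_lt_mul_of_pos_left hai h
        have h8 : 0 ≤ (1 - t) * cutFun (U j) x := mul_nonneg (by linarith) h3.le
        linarith
    · have h1 : (1 - t) • v x + t • (f' x).2 = 0 := congrArg Prod.snd hzero
      rw [hvv x (Or.inr hxB), hv0B x hxB, ← add_smul] at h1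
      simp only [sub_add_cancel, one_smul] at h1
      exact hB0 x hxB h1

/-! ### Covering theory -/

/-- Recursive assignment of members of the covers `W m` to members of the cover `G`. -/
def assignIdx {X ι : Type} [Inhabited ι] (C : ℕ → Set X) (G : ι → Set X)
    (p : ℕ → Set X → Set X) : ℕ → Set X → ι
  | 0, u => if h : ∃ j, u ⊆ G j then h.choose else default
  | m + 1, u => if (u ∩ C (m + 1)).Nonempty then assignIdx C G p m (p m u)
      else if h : ∃ j, u ⊆ G j then h.choose else default

theorem lemmaT {X : Type} [TopologicalSpace X] {ι : Type} {N : ℕ∞} (G : ι → Set X)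
    (C : ℕ → Set X) (hC0 : C 0 = ∅) (hC : ∀ m, IsClosed (C m))
    (hCi : ∀ m, C m ⊆ interior (C (m + 1))) (hCu : ⋃ m, C m = Set.univ)
    (W : ℕ → Set (Set X)) (hW : ∀ m, ∀ u ∈ W m, IsOpen u) (hWc : ∀ m, ⋃₀ (W m) = Set.univ)
    (hWr : ∀ m, ∀ u ∈ W (m + 1), ∃ v ∈ W m, u ⊆ v)
    (hWo : ∀ m x, {u ∈ W m | x ∈ u}.encard ≤ N)
    (hWG : ∀ m, ∀ u ∈ W m, (u ∩ C (m + 1)).Nonempty → ∃ j, u ⊆ G j) :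
    ∃ V : ι → Set X, (∀ j, IsOpen (V j)) ∧ (∀ j, V j ⊆ G j) ∧ (⋃ j, V j) = Set.univ ∧
      ∀ x, {j | x ∈ V j}.encard ≤ N := by
  rcases isEmpty_or_nonempty X with hX | ⟨⟨x₀⟩⟩
  · refine ⟨fun _ => ∅, fun _ => isOpen_empty, fun _ => empty_subset _, ?_, fun x => hX.elim x⟩
    rw [eq_univ_iff_forall]
    exact fun x => hX.elim x
  -- the index set is nonempty
  have hCmono : ∀ {a b}, a ≤ b → C a ⊆ C b := by
    intro a b hab
    induction hab with
    | refl => exact Subset.rfl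
    | step _ ih => exact ih.trans ((hCi _).trans interior_subset)
  have hfirst : ∀ x, ∃ a, x ∈ C (a + 1) ∧ x ∉ C a := by
    intro x
    have hex : ∃ m, x ∈ C m := by simpa using (hCu ▸ mem_univ x : x ∈ ⋃ m, C m)
    have h1 := Nat.find_spec hex
    obtain ⟨a, ha⟩ : ∃ a, Nat.find hex = a + 1 := by
      refine ⟨Nat.find hex - 1, ?_⟩
      have : Nat.find hex ≠ 0 := by
        intro h0
        rw [h0, hC0] at h1
        exact h1
      omega
    refine ⟨a, ha ▸ h1, Nat.find_min hex (by omega)⟩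
  have : Nonempty ι := by
    obtain ⟨a, ha, -⟩ := hfirst x₀
    obtain ⟨u, hu, hxu⟩ := mem_sUnion.1 ((hWc a) ▸ mem_univ x₀ : x₀ ∈ ⋃₀ (W a))
    obtain ⟨j, -⟩ := hWG a u hu ⟨x₀, hxu, ha⟩
    exact ⟨j⟩
  have : Inhabited ι := Classical.inhabited_of_nonempty this
  choose p hpW hpu using hWr
  let p' : ℕ → Set X → Set X := fun m u => if h : u ∈ W (m + 1) then p m u h else u
  have hp'W : ∀ m, ∀ u ∈ W (m + 1), p' m u ∈ W m := by
    intro m u hu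
    simp only [p', hu, dif_pos]
    exact hpW m u hu
  have hp'u : ∀ m, ∀ u ∈ W (m + 1), u ⊆ p' m u := by
    intro m u hu
    simp only [p', hu, dif_pos]
    exact hpu m u hu
  let τ : ℕ → Set X → ι := assignIdx C G p'
  have hτs : ∀ m u, (u ∩ C (m + 1)).Nonempty → τ (m + 1) u = τ m (p' m u) := by
    intro m u hu
    simp only [τ, assignIdx, hu, if_true]
  have hτG : ∀ m, ∀ u ∈ W m, (u ∩ C (m + 1)).Nonempty → u ⊆ G (τ m u) := by
    intro m
    induction m with
    | zero =>
      intro u hu hne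
      have hex := hWG 0 u hu hne
      simp only [τ, assignIdx, hex, dif_pos]
      exact hex.choose_spec
    | succ m ih =>
      intro u hu hne
      by_cases hhit : (u ∩ C (m + 1)).Nonempty
      · rw [hτs m u hhit]
        exact (hp'u m u hu).trans (ih _ (hp'W m u hu)
          (hhit.mono (inter_subset_inter_left _ (hp'u m u hu))))
      · have hex := hWG (m + 1) u hu hne
        simp only [τ, assignIdx, hhit, if_false, hex, dif_pos]
        exact hex.choose_spec
  refine ⟨fun j => ⋃ m, ⋃ u ∈ {u ∈ W m | τ m u = j}, u ∩ (interior (C (m + 1)) \ C (m - 1)),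
    ?_, ?_, ?_, ?_⟩
  · intro j
    refine isOpen_iUnion fun m => isOpen_biUnion fun u hu => ?_
    exact (hW m u hu.1).inter (isOpen_interior.sdiff (hC _))
  · intro j x hx
    obtain ⟨m, hx⟩ := mem_iUnion.1 hx
    obtain ⟨u, ⟨hu, rfl⟩, hxu, hxi, -⟩ := mem_iUnion₂.1 hx
    exact hτG m u hu ⟨x, hxu, interior_subset hxi⟩ hxu
  · rw [eq_univ_iff_forall]
    intro x
    obtain ⟨a, ha, ha'⟩ := hfirst x
    obtain ⟨u, hu, hxu⟩ := mem_sUnion.1 ((hWc (a + 1)) ▸ mem_univ x : x ∈ ⋃₀ (W (a + 1)))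
    refine mem_iUnion.2 ⟨τ (a + 1) u, mem_iUnion.2 ⟨a + 1, mem_iUnion₂.2 ⟨u, ⟨hu, rfl⟩, hxu, ?_, ?_⟩⟩⟩
    · exact hCi _ ha
    · simpa using ha'
  · intro x
    obtain ⟨a, ha, ha'⟩ := hfirst x
    refine le_trans (encard_le_encard ?_) ((encard_image_le (τ a) _).trans (hWo a x))
    intro j hj
    obtain ⟨m, hx⟩ := mem_iUnion.1 hj
    obtain ⟨u, ⟨hu, rfl⟩, hxu, hxi, hxn⟩ := mem_iUnion₂.1 hx
    have hm1 : a ≤ m := by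
      by_contra hlt
      exact ha' (hCmono (by omega) (interior_subset hxi))
    have hm2 : m ≤ a + 1 := by
      by_contra hlt
      exact hxn (hCmono (by omega) ha)
    rcases Nat.lt_or_ge a m with h | h
    · obtain rfl : m = a + 1 := by omega
      exact ⟨p' a u, ⟨hp'W a u hu, hp'u a u hu hxu⟩, (hτs a u ⟨x, hxu, ha⟩).symm⟩
    · obtain rfl : m = a := by omega
      exact ⟨u, ⟨hu, hxu⟩, rfl⟩

/-- Every open cover has an open refinement of order at most `N`. -/
def RefS (X : Type) [TopologicalSpace X] (N : ℕ) : Prop :=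
  ∀ 𝒰 : Set (Set X), (∀ u ∈ 𝒰, IsOpen u) → ⋃₀ 𝒰 = Set.univ →
    ∃ 𝒱 : Set (Set X), (∀ v ∈ 𝒱, IsOpen v) ∧ ⋃₀ 𝒱 = Set.univ ∧ (∀ v ∈ 𝒱, ∃ u ∈ 𝒰, v ⊆ u) ∧
      ∀ x, {v ∈ 𝒱 | x ∈ v}.encard ≤ N

theorem CovS.fin_refine {X : Type} [TopologicalSpace X] {N : ℕ} (h : CovS X N)
    (𝒰 : Set (Set X)) (hf : 𝒰.Finite) (ho : ∀ u ∈ 𝒰, IsOpen u) (hc : ⋃₀ 𝒰 = Set.univ) :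
    ∃ 𝒱 : Set (Set X), 𝒱.Finite ∧ (∀ v ∈ 𝒱, IsOpen v) ∧ ⋃₀ 𝒱 = Set.univ ∧
      (∀ v ∈ 𝒱, ∃ u ∈ 𝒰, v ⊆ u) ∧ ∀ x, {v ∈ 𝒱 | x ∈ v}.encard ≤ N := by
  have : Finite 𝒰 := hf
  obtain ⟨V, hV, hVU, hVc, hVn⟩ := h 𝒰 inferInstance (fun u => u) (fun u => ho u u.2)
    (by rw [← hc, sUnion_eq_iUnion])
  refine ⟨range V, finite_range V, by rintro _ ⟨i, rfl⟩; exact hV i, by rw [sUnion_range, hVc],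
    ?_, ?_⟩
  · rintro _ ⟨i, rfl⟩
    exact ⟨i, i.2, hVU i⟩
  · intro x
    have h1 : {v ∈ range V | x ∈ v} ⊆ V '' {i | x ∈ V i} := by
      rintro _ ⟨⟨i, rfl⟩, hx⟩
      exact ⟨i, hx, rfl⟩
    refine (encard_le_encard h1).trans ((encard_image_le _ _).trans ?_)
    rw [← (toFinite {i | x ∈ V i}).cast_ncard_eq]
    exact_mod_cast hVn x

theorem CovS.countable {X : Type} [MetricSpace X] {N : ℕ} (h : CovS X N)
    (G : ℕ → Set X) (hG : ∀ i, IsOpen (G i)) (hc : ⋃ i, G i = Set.univ) :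
    ∃ V : ℕ → Set X, (∀ j, IsOpen (V j)) ∧ (∀ j, V j ⊆ G j) ∧ (⋃ j, V j) = Set.univ ∧
      ∀ x, {j | x ∈ V j}.encard ≤ N := by
  let H : ℕ → Set X := fun m => ⋃ i ∈ Iio m, G i
  have hHo : ∀ m, IsOpen (H m) := fun m => isOpen_biUnion fun i _ => hG i
  have hHm : ∀ {a b}, a ≤ b → H a ⊆ H b := fun hab =>
    biUnion_subset_biUnion_left (Iio_subset_Iio hab)
  let C : ℕ → Set X := fun m => {x | ((m : ENNReal))⁻¹ ≤ Metric.infEDist x (H m)ᶜ}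
  have hCc : ∀ m, IsClosed (C m) := fun m =>
    isClosed_le continuous_const Metric.continuous_infEDist
  have hCH : ∀ m, C m ⊆ H m := by
    intro m x hx
    by_contra hxH
    have h1 : Metric.infEDist x (H m)ᶜ = 0 := Metric.infEDist_zero_of_mem hxH
    have h2 : ((m : ENNReal))⁻¹ ≤ Metric.infEDist x (H m)ᶜ := hx
    rw [h1] at h2
    simp at h2
  have hC0 : C 0 = ∅ := by
    have : H 0 = ∅ := by simp [H]
    exact subset_empty_iff.1 (this ▸ hCH 0)
  have hCi : ∀ m, C m ⊆ interior (C (m + 1)) := by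
    intro m
    have ho : IsOpen {x | ((m + 1 : ℕ) : ENNReal)⁻¹ < Metric.infEDist x (H (m + 1))ᶜ} :=
      isOpen_lt continuous_const Metric.continuous_infEDist
    refine Subset.trans ?_ (interior_maximal (fun x hx => ?_) ho)
    · intro x hx
      have h2 : ((m : ENNReal))⁻¹ ≤ Metric.infEDist x (H m)ᶜ := hx
      have h3 : Metric.infEDist x (H m)ᶜ ≤ Metric.infEDist x (H (m + 1))ᶜ :=
        Metric.infEDist_anti (compl_subset_compl.2 (hHm (Nat.le_succ m)))
      refine lt_of_lt_of_le ?_ (h2.trans h3)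
      rw [ENNReal.inv_lt_inv]
      exact_mod_cast Nat.lt_succ_self m
    · have hx' : ((m + 1 : ℕ) : ENNReal)⁻¹ < Metric.infEDist x (H (m + 1))ᶜ := hx
      exact hx'.le
  have hCu : ⋃ m, C m = Set.univ := by
    rw [eq_univ_iff_forall]
    intro x
    obtain ⟨i, hi⟩ := mem_iUnion.1 (hc ▸ mem_univ x)
    have hx : x ∈ H (i + 1) := mem_biUnion (show i ∈ Iio (i + 1) from Nat.lt_succ_self i) hi
    have h1 : 0 < Metric.infEDist x (H (i + 1))ᶜ := by
      rw [Metric.infEDist_pos_iff_notMem_closure, (hHo _).isClosed_compl.closure_eq]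
      simpa using hx
    obtain ⟨n, hn⟩ := ENNReal.exists_inv_nat_lt h1.ne'
    refine mem_iUnion.2 ⟨max n (i + 1), ?_⟩
    have h2 : Metric.infEDist x (H (i + 1))ᶜ ≤ Metric.infEDist x (H (max n (i + 1)))ᶜ :=
        Metric.infEDist_anti (compl_subset_compl.2 (hHm (le_max_right _ _)))
    have h3 : ((max n (i + 1) : ℕ) : ENNReal)⁻¹ ≤ (n : ENNReal)⁻¹ := by
      rw [ENNReal.inv_le_inv]
      exact_mod_cast le_max_left _ _
    exact h3.trans (hn.le.trans h2)
  let Good : Set (Set X) → Prop := fun W => W.Finite ∧ (∀ v ∈ W, IsOpen v) ∧ ⋃₀ W = Set.univ ∧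
    ∀ x, {v ∈ W | x ∈ v}.encard ≤ N
  have step : ∀ (m : ℕ) (W : {W // Good W}), ∃ W' : {W // Good W},
      (∀ u ∈ W'.1, ∃ v ∈ W.1, u ⊆ v) ∧
      (∀ u ∈ W'.1, (u ∩ C (m + 1)).Nonempty → ∃ j, u ⊆ G j) := by
    rintro m ⟨W, hWf, hWo, hWc, hWn⟩
    let 𝒢 : Set (Set X) := insert (C (m + 1))ᶜ (G '' Iio (m + 1))
    have h𝒢f : 𝒢.Finite := ((finite_Iio _).image _).insert _
    have h𝒢o : ∀ g ∈ 𝒢, IsOpen g := by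
      rintro g (rfl | ⟨i, -, rfl⟩)
      · exact (hCc _).isOpen_compl
      · exact hG i
    have h𝒢c : ∀ x, ∃ g ∈ 𝒢, x ∈ g := by
      intro x
      by_cases hx : x ∈ C (m + 1)
      · obtain ⟨i, hi, hxi⟩ := mem_iUnion₂.1 (hCH _ hx)
        exact ⟨G i, Or.inr ⟨i, hi, rfl⟩, hxi⟩
      · exact ⟨_, Or.inl rfl, hx⟩
    obtain ⟨W', hf', ho', hc', hr', hn'⟩ := h.fin_refine (image2 (· ∩ ·) W 𝒢) (hWf.image2 _ h𝒢f)
      (by rintro _ ⟨w, hw, g, hg, rfl⟩; exact (hWo w hw).inter (h𝒢o g hg)) (by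
        rw [eq_univ_iff_forall]
        intro x
        obtain ⟨w, hw, hxw⟩ := mem_sUnion.1 (hWc ▸ mem_univ x : x ∈ ⋃₀ W)
        obtain ⟨g, hg, hxg⟩ := h𝒢c x
        exact mem_sUnion.2 ⟨_, ⟨w, hw, g, hg, rfl⟩, hxw, hxg⟩)
    refine ⟨⟨W', hf', ho', hc', hn'⟩, ?_, ?_⟩
    · intro u hu
      obtain ⟨_, ⟨w, hw, g, hg, rfl⟩, hu'⟩ := hr' u hu
      exact ⟨w, hw, hu'.trans inter_subset_left⟩
    · intro u hu hne
      obtain ⟨_, ⟨w, hw, g, hg, rfl⟩, hu'⟩ := hr' u hu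
      rcases hg with rfl | ⟨i, -, rfl⟩
      · obtain ⟨x, hx, hxC⟩ := hne
        exact absurd hxC (hu' hx).2
      · exact ⟨i, hu'.trans inter_subset_right⟩
  obtain ⟨W₀, hf₀, ho₀, hc₀, -, hn₀⟩ := h.fin_refine {Set.univ} (finite_singleton _)
    (by simp) (by simp)
  choose nxt hn1 hn2 using step
  let s : ℕ → {W // Good W} := fun m =>
    Nat.rec (nxt 0 ⟨W₀, hf₀, ho₀, hc₀, hn₀⟩) (fun m W => nxt (m + 1) W) m
  refine lemmaT G C hC0 hCc hCi hCu (fun m => (s m).1) (fun m => (s m).2.2.1)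
    (fun m => (s m).2.2.2.1) (fun m => hn1 (m + 1) (s m)) (fun m => (s m).2.2.2.2) ?_
  intro m
  cases m with
  | zero => exact hn2 0 _
  | succ m => exact hn2 (m + 1) (s m)

/-- Theorem of Dowker for metric spaces. -/
theorem CovS.refS {X : Type} [MetricSpace X] {N : ℕ} (h : CovS X N) : RefS X N := by
  intro 𝒰 ho hc
  have hex : ∀ x, ∃ u : 𝒰, x ∈ (u : Set X) := by
    intro x
    obtain ⟨u, hu, hx⟩ := mem_sUnion.1 (hc ▸ mem_univ x : x ∈ ⋃₀ 𝒰)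
    exact ⟨⟨u, hu⟩, hx⟩
  have wf : WellFounded (WellOrderingRel : 𝒰 → 𝒰 → Prop) := IsWellFounded.wf
  let ind : X → 𝒰 := fun x => wf.min {u : 𝒰 | x ∈ (u : Set X)} (hex x)
  have hind : ∀ x, x ∈ (ind x : Set X) := fun x => wf.min_mem _ (hex x)
  have hnot : ∀ x (u : 𝒰), WellOrderingRel u (ind x) → x ∉ (u : Set X) := fun x u hu hx =>
    wf.not_lt_min _ hx hu
  let r : ℕ → ℝ := fun n => (1/2 : ℝ) ^ n
  have hr : ∀ n, 0 < r n := fun n => by positivity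
  let D : ℕ → 𝒰 → Set X := fun n u =>
    ⋃ x ∈ {x | ind x = u ∧ Metric.ball x (3 * r n) ⊆ u}, Metric.ball x (r n)
  have hDo : ∀ n u, IsOpen (D n u) := fun n u => isOpen_biUnion fun x _ => Metric.isOpen_ball
  have hDu : ∀ n u, D n u ⊆ u := by
    intro n u x hx
    obtain ⟨y, ⟨-, hy⟩, hxy⟩ := mem_iUnion₂.1 hx
    exact hy (Metric.ball_subset_ball (by linarith [hr n]) hxy)
  have hDlt : ∀ n u v x, WellOrderingRel u v → x ∈ D n u → x ∈ D n v → False := by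
    intro n u v x huv hxu hxv
    obtain ⟨y, ⟨hyi, hy⟩, hxy⟩ := mem_iUnion₂.1 hxu
    obtain ⟨z, ⟨hzi, hz⟩, hxz⟩ := mem_iUnion₂.1 hxv
    apply hnot z u (hzi ▸ huv)
    apply hy
    rw [Metric.mem_ball] at *
    have := dist_triangle z x y
    rw [dist_comm z x] at this
    linarith [hr n]
  have hDd : ∀ n u v x, x ∈ D n u → x ∈ D n v → u = v := by
    intro n u v x hu hv
    rcases trichotomous_of WellOrderingRel u v with h | h | h
    · exact (hDlt n u v x h hu hv).elim
    · exact h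
    · exact (hDlt n v u x h hv hu).elim
  obtain ⟨V, hV, hVD, hVc, hVn⟩ := h.countable (fun n => ⋃ u, D n u)
    (fun n => isOpen_iUnion fun u => hDo n u) (by
      rw [eq_univ_iff_forall]
      intro x
      obtain ⟨ε, hε, hxε⟩ := Metric.isOpen_iff.1 (ho _ (ind x).2) x (hind x)
      obtain ⟨n, hn⟩ := exists_pow_lt_of_lt_one (show 0 < ε / 3 by positivity)
        (show (1/2 : ℝ) < 1 by norm_num)
      refine mem_iUnion.2 ⟨n, mem_iUnion.2 ⟨ind x, mem_iUnion₂.2 ⟨x, ⟨rfl, ?_⟩, ?_⟩⟩⟩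
      · refine (Metric.ball_subset_ball ?_).trans hxε
        have : r n < ε / 3 := hn
        linarith
      · exact Metric.mem_ball_self (hr n))
  refine ⟨range (fun q : ℕ × 𝒰 => V q.1 ∩ D q.1 q.2), ?_, ?_, ?_, ?_⟩
  · rintro _ ⟨q, rfl⟩
    exact (hV _).inter (hDo _ _)
  · rw [eq_univ_iff_forall]
    intro x
    obtain ⟨n, hn⟩ := mem_iUnion.1 (hVc ▸ mem_univ x)
    obtain ⟨u, hu⟩ := mem_iUnion.1 (hVD n hn)
    exact mem_sUnion.2 ⟨_, ⟨(n, u), rfl⟩, hn, hu⟩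
  · rintro _ ⟨q, rfl⟩
    exact ⟨q.2, q.2.2, inter_subset_right.trans (hDu _ _)⟩
  · intro x
    refine le_trans (encard_le_encard ?_) ((encard_image_le
      (fun n => V n ∩ ⋃ u ∈ {u | x ∈ D n u}, D n u) _).trans (hVn x))
    rintro _ ⟨⟨⟨n, u⟩, rfl⟩, hxV, hxD⟩
    refine ⟨n, hxV, ?_⟩
    have : {u | x ∈ D n u} = {u} := by
      ext v
      exact ⟨fun hv => hDd n v u x hv hxD, fun hv => by rw [mem_singleton_iff] at hv; exact hv ▸ hxD⟩
    simp only [this, biUnion_singleton]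

/-- A Vopenka type criterion. -/
theorem covS_of_seq {X : Type} [MetricSpace X] {N : ℕ} (W : ℕ → Set (Set X))
    (hW : ∀ m, ∀ u ∈ W m, IsOpen u) (hWc : ∀ m, ⋃₀ (W m) = Set.univ)
    (hWr : ∀ m, ∀ u ∈ W (m + 1), ∃ v ∈ W m, u ⊆ v)
    (hWo : ∀ m x, {u ∈ W m | x ∈ u}.encard ≤ N)
    (hWd : ∀ m, ∀ u ∈ W m, Metric.ediam u < ((m + 1 : ℕ) : ENNReal)⁻¹) : CovS X N := by
  intro ι _ G hG hGc
  let C : ℕ → Set X := fun m => if m = 0 then ∅ else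
    ⋃ j, {x | (m : ENNReal)⁻¹ ≤ Metric.infEDist x (G j)ᶜ}
  have hCs : ∀ m, C (m + 1) = ⋃ j, {x | ((m + 1 : ℕ) : ENNReal)⁻¹ ≤ Metric.infEDist x (G j)ᶜ} :=
    fun m => by simp only [C, Nat.succ_ne_zero, if_false]
  have hCc : ∀ m, IsClosed (C m) := by
    intro m
    cases m with
    | zero => simp [C]
    | succ m =>
      rw [hCs]
      exact isClosed_iUnion_of_finite fun j =>
        isClosed_le continuous_const Metric.continuous_infEDist
  obtain ⟨V, hV, hVG, hVc, hVn⟩ := lemmaT (N := N) G C (by simp [C]) hCc (by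
    intro m
    cases m with
    | zero => simp [C]
    | succ m =>
      have ho : IsOpen (⋃ j, {x | ((m + 1 + 1 : ℕ) : ENNReal)⁻¹ < Metric.infEDist x (G j)ᶜ}) :=
        isOpen_iUnion fun j => isOpen_lt continuous_const Metric.continuous_infEDist
      refine Subset.trans ?_ (interior_maximal ?_ ho)
      · rw [hCs]
        refine iUnion_mono fun j x hx => ?_
        have hx' : ((m + 1 : ℕ) : ENNReal)⁻¹ ≤ Metric.infEDist x (G j)ᶜ := hx
        show ((m + 1 + 1 : ℕ) : ENNReal)⁻¹ < _
        refine lt_of_lt_of_le ?_ hx'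
        rw [ENNReal.inv_lt_inv]
        exact_mod_cast Nat.lt_succ_self (m + 1)
      · rw [hCs]
        refine iUnion_mono fun j x hx => ?_
        have hx' : ((m + 1 + 1 : ℕ) : ENNReal)⁻¹ < Metric.infEDist x (G j)ᶜ := hx
        exact hx'.le) (by
    rw [eq_univ_iff_forall]
    intro x
    obtain ⟨j, hj⟩ := mem_iUnion.1 (hGc ▸ mem_univ x)
    have h1 : 0 < Metric.infEDist x (G j)ᶜ := by
      rw [Metric.infEDist_pos_iff_notMem_closure, (hG _).isClosed_compl.closure_eq]
      simpa using hj
    obtain ⟨n, hn⟩ := ENNReal.exists_inv_nat_lt h1.ne'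
    refine mem_iUnion.2 ⟨n + 1, ?_⟩
    rw [hCs]
    refine mem_iUnion.2 ⟨j, le_trans ?_ hn.le⟩
    rw [ENNReal.inv_le_inv]
    exact_mod_cast Nat.le_succ n) W hW hWc hWr hWo (by
    rintro m u hu ⟨x, hxu, hxC⟩
    rw [hCs] at hxC
    obtain ⟨j, hj⟩ := mem_iUnion.1 hxC
    refine ⟨j, fun y hy => ?_⟩
    by_contra hyG
    have h1 : Metric.infEDist x (G j)ᶜ ≤ edist x y := Metric.infEDist_le_edist_of_mem hyG
    have h2 := Metric.edist_le_ediam_of_mem hxu hy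
    exact absurd (hWd m u hu) (not_lt.2 (le_trans hj (h1.trans h2))))
  refine ⟨V, hV, hVG, hVc, fun x => ?_⟩
  have := hVn x
  rw [← (toFinite {i | x ∈ V i}).cast_ncard_eq] at this
  exact_mod_cast this

theorem swell {X ι : Type} [TopologicalSpace X] [NormalSpace X] [Finite ι] (A : ι → Set X)
    (hA : ∀ i, IsClosed (A i)) (h0 : ⋂ i, A i = ∅) :
    ∃ U : ι → Set X, (∀ i, IsOpen (U i)) ∧ (∀ i, A i ⊆ U i) ∧ ⋂ i, closure (U i) = ∅ := by
  obtain ⟨v, hvc, hvo, hv⟩ := exists_iUnion_eq_closure_subset (u := fun i => (A i)ᶜ)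
    (fun i => (hA i).isOpen_compl) (fun x => Set.toFinite _)
    (by rw [← compl_iInter, h0, compl_empty])
  refine ⟨fun i => (closure (v i))ᶜ, fun i => isClosed_closure.isOpen_compl,
    fun i => subset_compl_comm.1 (hv i), ?_⟩
  have hs : ∀ i, closure (closure (v i))ᶜ ⊆ (v i)ᶜ := fun i =>
    closure_minimal (compl_subset_compl.2 subset_closure) (hvo i).isClosed_compl
  rw [eq_empty_iff_forall_notMem]
  intro x hx
  obtain ⟨i, hi⟩ := mem_iUnion.1 (hvc ▸ mem_univ x)
  exact hs i (mem_iInter.1 hx i) hi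

def colSet {X : Type} [MetricSpace X] (𝒱 : Set (Set X)) (s : Finset (Set X)) : Set X :=
  {x | ∃ a b : ℝ, 0 < a ∧ a < b ∧ (∀ i ∈ s, Metric.ball x b ⊆ i) ∧
    ∀ j ∈ 𝒱, j ∉ s → ¬ Metric.ball x a ⊆ j}

theorem colSet_open {X : Type} [MetricSpace X] (𝒱 : Set (Set X)) (s : Finset (Set X)) :
    IsOpen (colSet 𝒱 s) := by
  rw [Metric.isOpen_iff]
  rintro x ⟨a, b, ha, hab, h1, h2⟩
  refine ⟨(b - a) / 3, by linarith, fun y hy => ?_⟩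
  rw [Metric.mem_ball] at hy
  refine ⟨a + (b - a) / 3, b - (b - a) / 3, by linarith, by linarith, fun i hi => ?_,
    fun j hj hjs hb => h2 j hj hjs ?_⟩
  · exact (Metric.ball_subset_ball' (by linarith)).trans (h1 i hi)
  · refine Subset.trans (Metric.ball_subset_ball' ?_) hb
    rw [dist_comm] at hy
    linarith

theorem colSet_sub {X : Type} [MetricSpace X] {𝒱 : Set (Set X)} {s : Finset (Set X)} {i : Set X}
    (hi : i ∈ s) : colSet 𝒱 s ⊆ i := by
  rintro x ⟨a, b, ha, hab, h1, h2⟩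
  exact h1 i hi (Metric.mem_ball_self (by linarith))

theorem colSet_cmp {X : Type} [MetricSpace X] {𝒱 : Set (Set X)} {s t : Finset (Set X)}
    (hs : (s : Set (Set X)) ⊆ 𝒱) (ht : (t : Set (Set X)) ⊆ 𝒱) {x : X} (h1 : x ∈ colSet 𝒱 s)
    (h2 : x ∈ colSet 𝒱 t) : s ⊆ t ∨ t ⊆ s := by
  obtain ⟨a, b, ha, hab, h1, h1'⟩ := h1
  obtain ⟨a', b', ha', hab', h2, h2'⟩ := h2
  by_contra! h
  obtain ⟨i, hi, hit⟩ := Finset.not_subset.1 h.1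
  obtain ⟨j, hj, hjs⟩ := Finset.not_subset.1 h.2
  have e1 : b < a' := by
    by_contra! hc
    exact h2' i (hs hi) hit ((Metric.ball_subset_ball hc).trans (h1 i hi))
  have e2 : b' < a := by
    by_contra! hc
    exact h1' j (ht hj) hjs ((Metric.ball_subset_ball hc).trans (h2 j hj))
  linarith

theorem colSet_count {X : Type} [MetricSpace X] {𝒱 : Set (Set X)} (S : Set (Finset (Set X)))
    (hS : ∀ s ∈ S, (s : Set (Set X)) ⊆ 𝒱) (T : Finset ℕ) (hT : ∀ s ∈ S, s.card ∈ T) (x : X) :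
    {C ∈ colSet 𝒱 '' S | x ∈ C}.encard ≤ T.card := by
  have h1 : {C ∈ colSet 𝒱 '' S | x ∈ C} ⊆ colSet 𝒱 '' {s ∈ S | x ∈ colSet 𝒱 s} := by
    rintro _ ⟨⟨s, hs, rfl⟩, hx⟩
    exact ⟨s, ⟨hs, hx⟩, rfl⟩
  refine (encard_le_encard h1).trans ((encard_image_le _ _).trans ?_)
  have h2 : InjOn Finset.card {s ∈ S | x ∈ colSet 𝒱 s} := by
    rintro s ⟨hs, hxs⟩ t ⟨ht, hxt⟩ hc
    rcases colSet_cmp (hS s hs) (hS t ht) hxs hxt with h | h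
    · exact Finset.eq_of_subset_of_card_le h hc.ge
    · exact (Finset.eq_of_subset_of_card_le h hc.le).symm
  rw [← h2.encard_image, ← Set.encard_coe_eq_coe_finsetCard]
  refine encard_le_encard ?_
  rintro _ ⟨s, ⟨hs, -⟩, rfl⟩
  exact hT s hs

theorem colour {X : Type} [MetricSpace X] {k M : ℕ} (𝒱 : Set (Set X)) (ho : ∀ v ∈ 𝒱, IsOpen v)
    (hc : ⋃₀ 𝒱 = Set.univ) (hn : ∀ x, {v ∈ 𝒱 | x ∈ v}.encard ≤ (k + M : ℕ)) :
    ∃ 𝒞 𝒟 : Set (Set X), (∀ c ∈ 𝒞, IsOpen c ∧ ∃ v ∈ 𝒱, c ⊆ v) ∧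
      (∀ c ∈ 𝒟, IsOpen c ∧ ∃ v ∈ 𝒱, c ⊆ v) ∧ ⋃₀ 𝒞 ∪ ⋃₀ 𝒟 = Set.univ ∧
      (∀ x, {c ∈ 𝒞 | x ∈ c}.encard ≤ k) ∧ (∀ x, {c ∈ 𝒟 | x ∈ c}.encard ≤ M) := by
  let S1 : Set (Finset (Set X)) := {s | (s : Set (Set X)) ⊆ 𝒱 ∧ s.card ∈ Finset.Icc 1 k}
  let S2 : Set (Finset (Set X)) := {s | (s : Set (Set X)) ⊆ 𝒱 ∧ s.card ∈ Finset.Icc (k + 1) (k + M)}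
  refine ⟨colSet 𝒱 '' S1, colSet 𝒱 '' S2, ?_, ?_, ?_, fun x => ?_, fun x => ?_⟩
  · rintro _ ⟨s, ⟨hs, hs1⟩, rfl⟩
    refine ⟨colSet_open _ _, ?_⟩
    have : 0 < s.card := by have := Finset.mem_Icc.1 hs1; omega
    obtain ⟨i, hi⟩ := Finset.card_pos.1 this
    exact ⟨i, hs hi, colSet_sub hi⟩
  · rintro _ ⟨s, ⟨hs, hs1⟩, rfl⟩
    refine ⟨colSet_open _ _, ?_⟩
    have : 0 < s.card := by have := Finset.mem_Icc.1 hs1; omega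
    obtain ⟨i, hi⟩ := Finset.card_pos.1 this
    exact ⟨i, hs hi, colSet_sub hi⟩
  · rw [eq_univ_iff_forall]
    intro x
    have hf : {v ∈ 𝒱 | x ∈ v}.Finite := finite_of_encard_le_coe (hn x)
    have hcard : hf.toFinset.card ≤ k + M := by
      have := hn x
      rw [hf.encard_eq_coe_toFinset_card] at this
      exact_mod_cast this
    have hpos : 0 < hf.toFinset.card := by
      obtain ⟨v, hv, hx⟩ := mem_sUnion.1 (hc ▸ mem_univ x : x ∈ ⋃₀ 𝒱)
      exact Finset.card_pos.2 ⟨v, hf.mem_toFinset.2 ⟨hv, hx⟩⟩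
    have hsub : (hf.toFinset : Set (Set X)) ⊆ 𝒱 := by
      intro v hv
      exact (hf.mem_toFinset.1 hv).1
    have hxm : x ∈ colSet 𝒱 hf.toFinset := by
      have hnh : ⋂ v ∈ hf.toFinset, v ∈ 𝓝 x := by
        rw [Filter.biInter_finset_mem]
        intro v hv
        have := hf.mem_toFinset.1 hv
        exact (ho v this.1).mem_nhds this.2
      obtain ⟨b, hb, hbs⟩ := Metric.mem_nhds_iff.1 hnh
      refine ⟨b / 2, b, by linarith, by linarith, fun i hi => ?_, fun j hj hjs hh => ?_⟩
      · exact hbs.trans (biInter_subset_of_mem hi)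
      · exact hjs (hf.mem_toFinset.2 ⟨hj, hh (Metric.mem_ball_self (by linarith))⟩)
    by_cases hk : hf.toFinset.card ≤ k
    · exact Or.inl ⟨_, ⟨_, ⟨hsub, Finset.mem_Icc.2 ⟨hpos, hk⟩⟩, rfl⟩, hxm⟩
    · exact Or.inr ⟨_, ⟨_, ⟨hsub, Finset.mem_Icc.2 ⟨by omega, hcard⟩⟩, rfl⟩, hxm⟩
  · have := colSet_count (𝒱 := 𝒱) S1 (fun s hs => hs.1) (Finset.Icc 1 k) (fun s hs => hs.2) x
    simpa using this
  · have := colSet_count (𝒱 := 𝒱) S2 (fun s hs => hs.1) (Finset.Icc (k + 1) (k + M))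
      (fun s hs => hs.2) x
    simpa using this

theorem part_step {X : Type} [MetricSpace X] {k M : ℕ} (hR : RefS X (k + M))
    (A : Fin (k + 1) → Set X) (W : Set (Set X)) (hA : ∀ i, IsClosed (A i)) (hA0 : ⋂ i, A i = ∅)
    (hW : ∀ w ∈ W, IsOpen w) (hc : (⋃ i, A i) ∪ ⋃₀ W = Set.univ) (ε : ENNReal) (hε : 0 < ε) :
    ∃ (A' : Fin (k + 1) → Set X) (W' : Set (Set X)), ((∀ i, IsClosed (A' i)) ∧ ⋂ i, A' i = ∅ ∧
      (∀ w ∈ W', IsOpen w) ∧ (⋃ i, A' i) ∪ ⋃₀ W' = Set.univ) ∧ (∀ i, A i ⊆ interior (A' i)) ∧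
      (∀ u ∈ W', Metric.ediam u ≤ ε) ∧ (∀ u ∈ W', u ⊆ (⋃ i, A' i) ∨ ∃ v ∈ W, u ⊆ v) ∧
      ∀ x, {u ∈ W' | x ∈ u}.encard ≤ M := by
  obtain ⟨O, hO, hAO, hO0⟩ := swell A hA hA0
  obtain ⟨U, hU, hNU, hU0⟩ := swell (fun i => closure (O i)) (fun i => isClosed_closure) hO0
  obtain ⟨E, hEc, hE, hEU⟩ := exists_iUnion_eq_closed_subset (u := fun i => (closure (U i))ᶜ)
    (fun i => isClosed_closure.isOpen_compl) (fun x => Set.toFinite _)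
    (by rw [← compl_iInter, hU0, compl_empty])
  let 𝒰 : Set (Set X) := {u | IsOpen u ∧ Metric.ediam u ≤ ε ∧
    (u ⊆ (⋃ i, O i) ∨ ∃ v ∈ W, u ⊆ v) ∧ ∀ i, u ∩ E i = ∅ ∨ u ∩ U i = ∅}
  obtain ⟨𝒱, hVo, hVc, hVr, hVn⟩ := hR 𝒰 (fun u hu => hu.1) (by
    rw [eq_univ_iff_forall]
    intro x
    have h1 : ∃ u : Set X, IsOpen u ∧ x ∈ u ∧ (u ⊆ (⋃ i, O i) ∨ ∃ v ∈ W, u ⊆ v) := by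
      rcases (hc ▸ mem_univ x : x ∈ (⋃ i, A i) ∪ ⋃₀ W) with h | ⟨v, hv, hx⟩
      · exact ⟨⋃ i, O i, isOpen_iUnion hO, iUnion_mono hAO h, Or.inl Subset.rfl⟩
      · exact ⟨v, hW v hv, hx, Or.inr ⟨v, hv, Subset.rfl⟩⟩
    have h2 : ∀ i, ∃ u : Set X, IsOpen u ∧ x ∈ u ∧ (u ∩ E i = ∅ ∨ u ∩ U i = ∅) := by
      intro i
      by_cases hx : x ∈ E i
      · refine ⟨(closure (U i))ᶜ, isClosed_closure.isOpen_compl, hEU i hx, Or.inr ?_⟩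
        exact disjoint_iff_inter_eq_empty.1
          (disjoint_compl_left.mono_right subset_closure)
      · exact ⟨(E i)ᶜ, (hE i).isOpen_compl, hx, Or.inl (compl_inter_self _)⟩
    obtain ⟨u, huo, hux, hu⟩ := h1
    choose u' huo' hux' hu' using h2
    obtain ⟨r, hr, hrε⟩ : ∃ r : ENNReal, 0 < r ∧ 2 * r ≤ ε := by
      refine ⟨ε / 2, ENNReal.half_pos hε.ne', ?_⟩
      rw [ENNReal.mul_div_cancel (by simp) (by simp)]
    refine mem_sUnion.2 ⟨(u ∩ ⋂ i, u' i) ∩ Metric.eball x r, ⟨?_, ?_, ?_, ?_⟩, ?_⟩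
    · exact (huo.inter (isOpen_iInter_of_finite huo')).inter Metric.isOpen_eball
    · exact (Metric.ediam_mono inter_subset_right).trans (Metric.ediam_eball_le.trans hrε)
    · have hs : (u ∩ ⋂ i, u' i) ∩ Metric.eball x r ⊆ u := fun y hy => hy.1.1
      rcases hu with h | ⟨v, hv, h⟩
      · exact Or.inl (hs.trans h)
      · exact Or.inr ⟨v, hv, hs.trans h⟩
    · intro i
      have hs : (u ∩ ⋂ i, u' i) ∩ Metric.eball x r ⊆ u' i := fun y hy => mem_iInter.1 hy.1.2 i
      rcases hu' i with h | h
      · exact Or.inl (subset_empty_iff.1 (h ▸ inter_subset_inter_left _ hs))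
      · exact Or.inr (subset_empty_iff.1 (h ▸ inter_subset_inter_left _ hs))
    · exact ⟨⟨hux, mem_iInter.2 hux'⟩, Metric.mem_eball_self hr⟩)
  obtain ⟨𝒞, 𝒟, hC, hD, hCD, hCn, hDn⟩ := colour 𝒱 hVo hVc hVn
  have hC2 : ∀ c ∈ 𝒞, ∃ u ∈ 𝒰, c ⊆ u := fun c h => by
    obtain ⟨-, v, hv, hcv⟩ := hC c h
    obtain ⟨u, hu, hvu⟩ := hVr v hv
    exact ⟨u, hu, hcv.trans hvu⟩
  have hD2 : ∀ c ∈ 𝒟, ∃ u ∈ 𝒰, c ⊆ u := fun c h => by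
    obtain ⟨-, v, hv, hcv⟩ := hD c h
    obtain ⟨u, hu, hvu⟩ := hVr v hv
    exact ⟨u, hu, hcv.trans hvu⟩
  have ha : ∀ c : Set X, ∃ i, (∃ j, (c ∩ U j).Nonempty) → (c ∩ U i).Nonempty := by
    intro c
    by_cases h : ∃ j, (c ∩ U j).Nonempty
    · obtain ⟨j, hj⟩ := h
      exact ⟨j, fun _ => hj⟩
    · exact ⟨0, fun h' => absurd h' h⟩
  choose a ha using ha
  let U' : Fin (k + 1) → Set X := fun i => U i ∪ ⋃₀ {c ∈ 𝒞 | a c = i}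
  have hU' : ∀ i, IsOpen (U' i) := fun i => (hU i).union (isOpen_sUnion fun c hc => (hC c hc.1).1)
  have hU'0 : ⋂ i, U' i = ∅ := by
    rw [eq_empty_iff_forall_notMem]
    intro x hx
    rw [mem_iInter] at hx
    by_cases hex : ∃ c ∈ 𝒞, x ∈ c ∧ ∀ j, ¬ (c ∩ U j).Nonempty
    · obtain ⟨c0, hc0, hxc0, hmiss⟩ := hex
      have hxU : ∀ i, x ∉ U i := fun i hi => hmiss i ⟨x, hxc0, hi⟩
      have hall : ∀ i, i ∈ a '' {c ∈ 𝒞 | x ∈ c} := by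
        intro i
        rcases hx i with h | ⟨c, ⟨hc, hac⟩, hxc⟩
        · exact absurd h (hxU i)
        · exact ⟨c, ⟨hc, hxc⟩, hac⟩
      have h1 : (Set.univ : Set (Fin (k + 1))).encard ≤ k :=
        (encard_le_encard fun i _ => hall i).trans ((encard_image_le _ _).trans (hCn x))
      rw [encard_univ, ENat.card_eq_coe_fintype_card, Fintype.card_fin] at h1
      have h2 : k + 1 ≤ k := by exact_mod_cast h1
      omega
    · push Not at hex
      obtain ⟨i, hi⟩ := mem_iUnion.1 (hEc ▸ mem_univ x)
      rcases hx i with h | ⟨c, ⟨hc, hac⟩, hxc⟩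
      · exact hEU i hi (subset_closure h)
      · have h1 := ha c (hex c hc hxc)
        rw [hac] at h1
        obtain ⟨u, hu, hcu⟩ := hC2 c hc
        rcases hu.2.2.2 i with h | h
        · exact (h ▸ (⟨hcu hxc, hi⟩ : x ∈ u ∩ E i) : x ∈ (∅ : Set X))
        · obtain ⟨y, hy1, hy2⟩ := h1
          exact (h ▸ (⟨hcu hy1, hy2⟩ : y ∈ u ∩ U i) : y ∈ (∅ : Set X))
  have hDo : IsOpen (⋃₀ 𝒟) := isOpen_sUnion fun c hc => (hD c hc).1
  obtain ⟨B, hBc, hB, hBU⟩ := exists_subset_iUnion_closed_subset (u := U') hDo.isClosed_compl hU'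
    (fun x _ => Set.toFinite _) (by
      intro x hx
      rcases (hCD ▸ mem_univ x : x ∈ ⋃₀ 𝒞 ∪ ⋃₀ 𝒟) with ⟨c, hc, hxc⟩ | h
      · exact mem_iUnion.2 ⟨a c, Or.inr ⟨c, ⟨hc, rfl⟩, hxc⟩⟩
      · exact absurd h hx)
  refine ⟨fun i => closure (O i) ∪ B i, 𝒟, ⟨fun i => isClosed_closure.union (hB i), ?_,
    fun w hw => (hD w hw).1, ?_⟩, fun i => ?_, ?_, ?_, hDn⟩
  · rw [← subset_empty_iff, ← hU'0]
    refine iInter_mono fun i => union_subset ?_ (hBU i)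
    exact (hNU i).trans subset_union_left
  · rw [eq_univ_iff_forall]
    intro x
    by_cases hx : x ∈ ⋃₀ 𝒟
    · exact Or.inr hx
    · obtain ⟨i, hi⟩ := mem_iUnion.1 (hBc hx)
      exact Or.inl (mem_iUnion.2 ⟨i, Or.inr hi⟩)
  · exact (hAO i).trans (interior_maximal (subset_closure.trans subset_union_left) (hO i))
  · intro u hu
    obtain ⟨v, hv, huv⟩ := hD2 u hu
    exact (Metric.ediam_mono huv).trans hv.2.1
  · intro u hu
    obtain ⟨v, hv, huv⟩ := hD2 u hu
    rcases hv.2.2.1 with h | ⟨w, hw, h⟩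
    · exact Or.inl (huv.trans (h.trans (iUnion_mono fun i =>
        subset_closure.trans subset_union_left)))
    · exact Or.inr ⟨w, hw, huv.trans h⟩

structure PState (X : Type) [MetricSpace X] (k : ℕ) where
  A : Fin (k + 1) → Set X
  W : Set (Set X)
  hA : ∀ i, IsClosed (A i)
  hA0 : ⋂ i, A i = ∅
  hW : ∀ w ∈ W, IsOpen w
  hc : (⋃ i, A i) ∪ ⋃₀ W = Set.univ

theorem part_step' {X : Type} [MetricSpace X] {k M : ℕ} (hR : RefS X (k + M))
    (m : ℕ) (p : PState X k) : ∃ q : PState X k, (∀ i, p.A i ⊆ interior (q.A i)) ∧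
      (∀ u ∈ q.W, Metric.ediam u ≤ ((m + 2 : ℕ) : ENNReal)⁻¹) ∧
      (∀ u ∈ q.W, u ⊆ (⋃ i, q.A i) ∨ ∃ v ∈ p.W, u ⊆ v) ∧
      ∀ x, {u ∈ q.W | x ∈ u}.encard ≤ M := by
  obtain ⟨A', W', ⟨h1, h2, h3, h4⟩, h5, h6, h7, h8⟩ := part_step hR p.A p.W p.hA p.hA0 p.hW p.hc
    ((m + 2 : ℕ) : ENNReal)⁻¹ (by simp)
  exact ⟨⟨A', W', h1, h2, h3, h4⟩, h5, h6, h7, h8⟩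

theorem CovS.partition {X : Type} [MetricSpace X] {k M : ℕ} (h : CovS X (k + M))
    (F : Fin (k + 1) → Set X) (hF : ∀ i, IsClosed (F i)) (hF0 : ⋂ i, F i = ∅) :
    ∃ U : Fin (k + 1) → Set X, (∀ i, IsOpen (U i)) ∧ ⋂ i, U i = ∅ ∧ (∀ i, F i ⊆ U i) ∧
      CovS (↥((⋃ i, U i)ᶜ)) M := by
  choose nx hn1 hn2 hn3 hn4 using part_step' h.refS
  let S : ℕ → PState X k := fun m => Nat.rec
    ⟨F, {Set.univ}, hF, hF0, by simp, by simp⟩ (fun m p => nx m p) m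
  have hS : ∀ m, S (m + 1) = nx m (S m) := fun m => rfl
  have s1 : ∀ m i, (S m).A i ⊆ interior ((S (m + 1)).A i) := fun m => hn1 m (S m)
  have s2 : ∀ m, ∀ u ∈ (S (m + 1)).W, Metric.ediam u ≤ ((m + 2 : ℕ) : ENNReal)⁻¹ :=
    fun m => hn2 m (S m)
  have s3 : ∀ m, ∀ u ∈ (S (m + 1)).W, u ⊆ (⋃ i, (S (m + 1)).A i) ∨ ∃ v ∈ (S m).W, u ⊆ v :=
    fun m => hn3 m (S m)
  have s4 : ∀ m x, {u ∈ (S (m + 1)).W | x ∈ u}.encard ≤ M := fun m => hn4 m (S m)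
  have hmono : ∀ i, Monotone fun m => (S m).A i := fun i =>
    monotone_nat_of_le_succ fun m => (s1 m i).trans interior_subset
  let U : Fin (k + 1) → Set X := fun i => ⋃ m, (S m).A i
  have hAU : ∀ m, (⋃ i, (S m).A i) ⊆ ⋃ i, U i := fun m =>
    iUnion_mono fun i => subset_iUnion (fun m => (S m).A i) m
  refine ⟨U, fun i => ?_, ?_, fun i => subset_iUnion (fun m => (S m).A i) 0, ?_⟩
  · have : U i = ⋃ m, interior ((S m).A i) := by
      refine subset_antisymm (iUnion_subset fun m => ?_) (iUnion_mono fun m => interior_subset)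
      exact (s1 m i).trans (subset_iUnion (fun m => interior ((S m).A i)) (m + 1))
    rw [this]
    exact isOpen_iUnion fun m => isOpen_interior
  · rw [eq_empty_iff_forall_notMem]
    intro x hx
    rw [mem_iInter] at hx
    have hx' : ∀ i, ∃ m, x ∈ (S m).A i := fun i => mem_iUnion.1 (hx i)
    choose m hm using hx'
    have : x ∈ ⋂ i, (S (Finset.univ.sup m)).A i := mem_iInter.2 fun i =>
      hmono i (Finset.le_sup (f := m) (Finset.mem_univ i)) (hm i)
    rw [(S _).hA0] at this
    exact this
  · set P : Set X := (⋃ i, U i)ᶜ with hP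
    let T : ℕ → Set (Set P) := fun m =>
      (fun u : Set X => (Subtype.val ⁻¹' u : Set P)) '' {u ∈ (S (m + 1)).W | (u ∩ P).Nonempty}
    refine covS_of_seq T ?_ ?_ ?_ ?_ ?_
    · rintro m _ ⟨u, ⟨hu, -⟩, rfl⟩
      exact ((S (m + 1)).hW u hu).preimage continuous_subtype_val
    · intro m
      rw [eq_univ_iff_forall]
      rintro ⟨x, hx⟩
      rcases ((S (m + 1)).hc ▸ mem_univ x : x ∈ (⋃ i, (S (m + 1)).A i) ∪ ⋃₀ (S (m + 1)).W) with
        h | ⟨u, hu, hxu⟩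
      · exact absurd (hAU (m + 1) h) hx
      · exact ⟨_, ⟨u, ⟨hu, ⟨x, hxu, hx⟩⟩, rfl⟩, hxu⟩
    · rintro m _ ⟨u, ⟨hu, ⟨x, hxu, hxP⟩⟩, rfl⟩
      rcases s3 (m + 1) u hu with h | ⟨v, hv, huv⟩
      · exact absurd (hAU (m + 1 + 1) (h hxu)) hxP
      · exact ⟨_, ⟨v, ⟨hv, ⟨x, huv hxu, hxP⟩⟩, rfl⟩, preimage_mono huv⟩
    · rintro m ⟨x, hx⟩
      refine le_trans (le_trans (encard_le_encard ?_) (encard_image_le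
        (fun u : Set X => (Subtype.val ⁻¹' u : Set P)) _)) (s4 m x)
      rintro _ ⟨⟨u, ⟨hu, -⟩, rfl⟩, hxu⟩
      exact ⟨u, ⟨hu, hxu⟩, rfl⟩
    · rintro m _ ⟨u, ⟨hu, -⟩, rfl⟩
      have h1 : Metric.ediam (Subtype.val ⁻¹' u : Set P) ≤ Metric.ediam u := by
        rw [← isometry_subtype_coe.ediam_image]
        exact Metric.ediam_mono (image_preimage_subset _ _)
      refine lt_of_le_of_lt (h1.trans (s2 m u hu)) ?_
      rw [ENNReal.inv_lt_inv]
      exact_mod_cast Nat.lt_succ_self (m + 1)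

theorem isKTuple_iff {k : ℕ} {X : Type} (A : Fin (k + 1) → Set X) :
    IsKTuple (bComplex k) A ↔ ⋂ i, A i = ∅ := by
  constructor
  · intro h
    by_contra hne
    refine h Finset.univ Finset.univ_nonempty ?_ rfl
    simpa using nonempty_iff_ne_empty.2 hne
  · rintro h I - ⟨x, hx⟩ rfl
    have : x ∈ ⋂ i, A i := by simpa using hx
    rw [h] at this
    exact this

theorem kIndLE_iff {k : ℕ} (X : Type) [TopologicalSpace X] (α : Ordinal.{0}) :
    KIndLE (bComplex k) X α ↔ ∀ F : Fin (k + 1) → Set X, (∀ i, IsClosed (F i)) → ⋂ i, F i = ∅ →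
      ∃ U : Fin (k + 1) → Set X, (∀ i, IsOpen (U i)) ∧ ⋂ i, U i = ∅ ∧ (∀ i, F i ⊆ U i) ∧
        ((⋃ i, U i)ᶜ = (∅ : Set X) ∨ ∃ β < α, KIndLE (bComplex k) (↥((⋃ i, U i)ᶜ)) β) := by
  have h : KIndLeAux (bComplex k) α X inferInstance =
      ∀ F : Fin (k + 1) → Set X, (∀ i, IsClosed (F i)) → IsKTuple (bComplex k) F →
      ∃ U : Fin (k + 1) → Set X, (∀ i, IsOpen (U i)) ∧ IsKTuple (bComplex k) U ∧
        (∀ i, F i ⊆ U i) ∧ ((⋃ i, U i)ᶜ = (∅ : Set X) ∨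
          ∃ β : Set.Iio α, KIndLeAux (bComplex k) β.1 (↥((⋃ i, U i)ᶜ)) inferInstance) := by
    conv_lhs => rw [KIndLeAux, WellFounded.fix_eq]
    rfl
  show KIndLeAux (bComplex k) α X inferInstance ↔ _
  rw [h]
  simp only [isKTuple_iff, Subtype.exists, exists_prop, mem_Iio]
  rfl

theorem CovS.mono {X : Type} [TopologicalSpace X] {N N' : ℕ} (h : CovS X N) (hN : N ≤ N') :
    CovS X N' := by
  intro ι hι U hU hc
  obtain ⟨V, h1, h2, h3, h4⟩ := h ι hι U hU hc
  exact ⟨V, h1, h2, h3, fun x => (h4 x).trans hN⟩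

theorem covS_of_isEmpty {X : Type} [TopologicalSpace X] [IsEmpty X] (N : ℕ) : CovS X N :=
  fun _ _ U hU hc => ⟨U, hU, fun _ => Subset.rfl, hc, fun x => isEmptyElim x⟩

theorem CovS.isEmpty {X : Type} [TopologicalSpace X] (h : CovS X 0) : IsEmpty X := by
  refine ⟨fun x => ?_⟩
  obtain ⟨V, h1, h2, h3, h4⟩ := h Unit inferInstance (fun _ => Set.univ) (fun _ => isOpen_univ)
    (iUnion_const _)
  obtain ⟨i, hi⟩ := mem_iUnion.1 (h3 ▸ mem_univ x)
  have h5 := h4 x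
  rw [Nat.le_zero, ncard_eq_zero] at h5
  exact (h5 ▸ (show i ∈ {i | x ∈ V i} from hi) : i ∈ (∅ : Set Unit))

theorem CovS.kIndLE {k : ℕ} (m : ℕ) : ∀ (X : Type) [MetricSpace X], CovS X (k * (m + 1)) →
    KIndLE (bComplex k) X (m : Ordinal.{0}) := by
  induction m with
  | zero =>
    intro X _ h
    rw [kIndLE_iff]
    intro F hF hF0
    obtain ⟨U, h1, h2, h3, h4⟩ := CovS.partition (k := k) (M := 0) (by simpa using h) F hF hF0
    exact ⟨U, h1, h2, h3, Or.inl (isEmpty_coe_sort.1 h4.isEmpty)⟩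
  | succ m ih =>
    intro X _ h
    rw [kIndLE_iff]
    intro F hF hF0
    obtain ⟨U, h1, h2, h3, h4⟩ := CovS.partition (k := k) (M := k * (m + 1))
      (by convert h using 1; ring) F hF hF0
    exact ⟨U, h1, h2, h3, Or.inr ⟨m, by exact_mod_cast Nat.lt_succ_self m, ih _ h4⟩⟩

theorem KIndLE.covS {k : ℕ} (m : ℕ) : ∀ (X : Type) [MetricSpace X],
    KIndLE (bComplex k) X (m : Ordinal.{0}) → CovS X (k * (m + 1)) := by
  induction m using Nat.strong_induction_on with
  | _ m ih =>
    intro X _ h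
    rw [kIndLE_iff] at h
    have h1 : NVExt ((Fin k → ℝ) × (Fin (k * m) → ℝ)) X := by
      refine nvExt_prod fun F hF hF0 => ?_
      obtain ⟨U, h1, h2, h3, h4⟩ := h F hF hF0
      refine ⟨U, h1, h2, h3, CovS.nvExt ?_⟩
      rw [Module.finrank_fin_fun]
      rcases h4 with h4 | ⟨β, hβ, h4⟩
      · have := isEmpty_coe_sort.2 h4
        exact covS_of_isEmpty _
      · obtain ⟨b, rfl⟩ := Ordinal.lt_omega0.1 (hβ.trans (Ordinal.natCast_lt_omega0 m))
        have hb : b < m := by exact_mod_cast hβ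
        exact (ih b hb _ h4).mono (Nat.mul_le_mul_left _ hb)
    refine NVExt.covS (h1.congr ?_)
    rw [Module.finrank_prod, Module.finrank_fin_fun, Module.finrank_fin_fun,
      Module.finrank_fin_fun]
    ring

theorem joinHomeo {E E' A B : Type} [NormedAddCommGroup E] [NormedSpace ℝ E]
    [FiniteDimensional ℝ E] [NormedAddCommGroup E'] [NormedSpace ℝ E'] [FiniteDimensional ℝ E']
    [Nontrivial E] [Nontrivial E'] [TopologicalSpace A] [TopologicalSpace B]
    (φ : A ≃ₜ Metric.sphere (0 : E) 1) (ψ : B ≃ₜ Metric.sphere (0 : E') 1) :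
    Nonempty (Join A B ≃ₜ Metric.sphere (0 : WithLp 1 (E × E')) 1) := by
  have : ProperSpace E := FiniteDimensional.proper ℝ E
  have : ProperSpace E' := FiniteDimensional.proper ℝ E'
  have : CompactSpace A := φ.symm.compactSpace
  have : CompactSpace B := ψ.symm.compactSpace
  have hφ : ∀ a, ‖(φ a : E)‖ = 1 := fun a => by simpa using (φ a).2
  have hψ : ∀ a, ‖(ψ a : E')‖ = 1 := fun a => by simpa using (ψ a).2
  let f : A × B × unitInterval → WithLp 1 (E × E') := fun p =>
    WithLp.toLp 1 ((1 - (p.2.2 : ℝ)) • (φ p.1 : E), (p.2.2 : ℝ) • (ψ p.2.1 : E'))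
  have hf : Continuous f := by
    refine (WithLp.prod_continuous_toLp 1 E E').comp ?_
    fun_prop
  have hfn : ∀ p, f p ∈ Metric.sphere (0 : WithLp 1 (E × E')) 1 := by
    intro p
    rw [mem_sphere_zero_iff_norm, WithLp.prod_norm_eq_of_L1]
    show ‖(1 - (p.2.2 : ℝ)) • (φ p.1 : E)‖ + ‖(p.2.2 : ℝ) • (ψ p.2.1 : E')‖ = 1
    rw [norm_smul, norm_smul, hφ, hψ, Real.norm_of_nonneg p.2.2.2.1,
      Real.norm_of_nonneg (by linarith [p.2.2.2.2])]
    ring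
  have hrel : ∀ p q, JoinRel A B p q → f p = f q := by
    rintro ⟨a, b, t⟩ ⟨a', b', t'⟩ (⟨h1, h2, h3⟩ | ⟨h1, h2, h3⟩) <;>
    · simp only at h1 h2 h3
      subst h1 h2 h3
      simp [f]
  let g : Join A B → Metric.sphere (0 : WithLp 1 (E × E')) 1 :=
    Quot.lift (fun p => ⟨f p, hfn p⟩) (fun p q h => Subtype.ext (hrel p q h))
  have hg : Continuous g := continuous_quot_lift _ (hf.subtype_mk _)
  have hinj : Function.Injective g := by
    rintro ⟨a, b, t⟩ ⟨a', b', t'⟩ h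
    have h0 : f (a, b, t) = f (a', b', t') := congrArg Subtype.val h
    have h1 : (1 - (t : ℝ)) • (φ a : E) = (1 - (t' : ℝ)) • (φ a' : E) := congrArg (fun z => z.fst) h0
    have h2 : (t : ℝ) • (ψ b : E') = (t' : ℝ) • (ψ b' : E') := congrArg (fun z => z.snd) h0
    have ht : t = t' := by
      have := congrArg norm h2
      rw [norm_smul, norm_smul, hψ, hψ, Real.norm_of_nonneg t.2.1,
        Real.norm_of_nonneg t'.2.1] at this
      exact Subtype.ext (by linarith)
    subst ht
    by_cases ht0 : t = 0
    · refine Quot.sound (Or.inl ⟨ht0, ht0, ?_⟩)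
      subst ht0
      exact φ.injective (Subtype.ext (by simpa using h1))
    by_cases ht1 : t = 1
    · refine Quot.sound (Or.inr ⟨ht1, ht1, ?_⟩)
      subst ht1
      exact ψ.injective (Subtype.ext (by simpa using h2))
    have e1 : a = a' := φ.injective (Subtype.ext (smul_right_injective E
      (show 1 - (t : ℝ) ≠ 0 from fun hh => ht1 (Subtype.ext (by
        show (t : ℝ) = 1
        linarith))) h1))
    have e2 : b = b' := ψ.injective (Subtype.ext (smul_right_injective E'
      (show (t : ℝ) ≠ 0 from fun hh => ht0 (Subtype.ext hh)) h2))
    rw [e1, e2]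
  have hdir : ∀ (G C : Type) [NormedAddCommGroup G] [NormedSpace ℝ G] [Nontrivial G]
      [TopologicalSpace C] (χ : C ≃ₜ Metric.sphere (0 : G) 1) (u : G),
      ∃ c : C, ‖u‖ • (χ c : G) = u := by
    intro G C _ _ _ _ χ u
    by_cases hu : u = 0
    · obtain ⟨z, hz⟩ := (NormedSpace.sphere_nonempty (E := G) (x := 0) (r := 1)).2 zero_le_one
      exact ⟨χ.symm ⟨z, hz⟩, by simp [hu]⟩
    · have hn : ‖u‖ ≠ 0 := norm_ne_zero_iff.2 hu
      refine ⟨χ.symm ⟨‖u‖⁻¹ • u, by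
        rw [mem_sphere_zero_iff_norm, norm_smul, norm_inv, norm_norm, inv_mul_cancel₀ hn]⟩, ?_⟩
      rw [χ.apply_symm_apply, smul_smul, mul_inv_cancel₀ hn, one_smul]
  have hsurj : Function.Surjective g := by
    rintro ⟨z, hz⟩
    rw [mem_sphere_zero_iff_norm, WithLp.prod_norm_eq_of_L1] at hz
    obtain ⟨a, ha⟩ := hdir E A φ z.fst
    obtain ⟨b, hb⟩ := hdir E' B ψ z.snd
    refine ⟨Quot.mk _ (a, b, ⟨‖z.snd‖, norm_nonneg _, by linarith [norm_nonneg z.fst]⟩), ?_⟩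
    refine Subtype.ext ?_
    show WithLp.toLp 1 ((1 - ‖z.snd‖) • (φ a : E), ‖z.snd‖ • (ψ b : E')) = z
    rw [hb, show 1 - ‖z.snd‖ = ‖z.fst‖ by linarith, ha]
    rfl
  have : CompactSpace (Join A B) := inferInstance
  exact ⟨Continuous.homeoOfEquivCompactToT2 (f := Equiv.ofBijective g ⟨hinj, hsurj⟩) hg⟩

theorem joinPow_sphere (k : ℕ) (hk : 1 ≤ k) (m : ℕ) :
    ∃ (E : Type) (_ : NormedAddCommGroup E) (_ : NormedSpace ℝ E) (_ : FiniteDimensional ℝ E),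
      Module.finrank ℝ E = k * (m + 1) ∧
      Nonempty (JoinPow (↥(Metric.sphere (0 : EuclideanSpace ℝ (Fin k)) 1)) m ≃ₜ
        Metric.sphere (0 : E) 1) := by
  induction m with
  | zero =>
    exact ⟨EuclideanSpace ℝ (Fin k), inferInstance, inferInstance, inferInstance, by simp,
      ⟨Homeomorph.refl _⟩⟩
  | succ m ih =>
    obtain ⟨E, _, _, _, hE, ⟨ψ⟩⟩ := ih
    have : Nontrivial E := Module.nontrivial_of_finrank_pos (R := ℝ) (by rw [hE]; positivity)
    have : Nontrivial (EuclideanSpace ℝ (Fin k)) :=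
      Module.nontrivial_of_finrank_pos (R := ℝ) (by rw [finrank_euclideanSpace_fin]; exact hk)
    have hj := joinHomeo (Homeomorph.refl (Metric.sphere (0 : EuclideanSpace ℝ (Fin k)) 1)) ψ
    refine ⟨WithLp 1 (EuclideanSpace ℝ (Fin k) × E), inferInstance, inferInstance,
      (WithLp.linearEquiv 1 ℝ (EuclideanSpace ℝ (Fin k) × E)).symm.finiteDimensional, ?_, hj⟩
    rw [(WithLp.linearEquiv 1 ℝ (EuclideanSpace ℝ (Fin k) × E)).finrank_eq, Module.finrank_prod, hE]
    simp
    ring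

theorem lDimLE_iff_nvExt {L E : Type} [TopologicalSpace L] [NormedAddCommGroup E]
    [NormedSpace ℝ E] [FiniteDimensional ℝ E] {m : ℕ} (φ : JoinPow L m ≃ₜ Metric.sphere (0 : E) 1)
    (X : Type) [MetricSpace X] : LDimLE L X m ↔ NVExt E X := by
  have hφ : ∀ a, ‖(φ a : E)‖ = 1 := fun a => by simpa using (φ a).2
  have hnrm : ∀ u : E, u ≠ 0 → ‖u‖⁻¹ • u ∈ Metric.sphere (0 : E) 1 := fun u hu => by
    rw [mem_sphere_zero_iff_norm, norm_smul, norm_inv, norm_norm,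
      inv_mul_cancel₀ (norm_ne_zero_iff.2 hu)]
  constructor
  · intro h F hF f hf hf0
    have hfr : Continuous fun x : F => f x := hf.domRestrict
    have hc : Continuous fun x : F => φ.symm ⟨‖f x‖⁻¹ • f x, hnrm _ (hf0 x x.2)⟩ := by
      refine φ.symm.continuous.comp (Continuous.subtype_mk ?_ _)
      exact (hfr.norm.inv₀ fun x => norm_ne_zero_iff.2 (hf0 x x.2)).smul hfr
    obtain ⟨g, hg⟩ := h F hF ⟨_, hc⟩
    refine homotopy_ext hF hf (h := fun x => (φ (g x) : E)) (by fun_prop)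
      (fun x hx => by simpa [hx] using hφ (g x)) ?_
    intro x hx t ht0 ht1
    have e : (φ (g x) : E) = ‖f x‖⁻¹ • f x := by
      have := hg ⟨x, hx⟩
      simp only [ContinuousMap.coe_mk] at this
      rw [this, φ.apply_symm_apply]
    simp only [e]
    rw [smul_smul, ← add_smul]
    have hpos : 0 < ‖f x‖ := norm_pos_iff.2 (hf0 x hx)
    refine smul_ne_zero ?_ (hf0 x hx)
    have h1 : 0 ≤ (1 - t) * ‖f x‖⁻¹ := mul_nonneg (by linarith) (by positivity)
    rcases eq_or_lt_of_le ht0 with rfl | ht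
    · simpa using (hf0 x hx)
    · positivity
  · intro h F hF f
    let f' : X → E := fun x => if hx : x ∈ F then (φ (f ⟨x, hx⟩) : E) else 0
    have hf' : ContinuousOn f' F := by
      rw [continuousOn_iff_continuous_domRestrict]
      have : F.domRestrict f' = fun x => (φ (f x) : E) := by
        funext x
        simp [f', Set.domRestrict]
      rw [this]
      fun_prop
    obtain ⟨g, hg, hg0, hgf⟩ := h F hF f' hf' (fun x hx => by
      simp only [f', hx, dif_pos]
      intro h0
      simpa [h0] using hφ (f ⟨x, hx⟩))
    refine ⟨⟨fun x => φ.symm ⟨‖g x‖⁻¹ • g x, hnrm _ (hg0 x)⟩, ?_⟩, fun x => ?_⟩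
    · refine φ.symm.continuous.comp (Continuous.subtype_mk ?_ _)
      exact (hg.norm.inv₀ fun x => norm_ne_zero_iff.2 (hg0 x)).smul hg
    · show φ.symm _ = f x
      rw [φ.symm_apply_eq]
      refine Subtype.ext ?_
      show ‖g x‖⁻¹ • g x = φ (f x)
      have e : g x = φ (f x) := by
        rw [hgf x x.2]
        simp [f']
      rw [e, hφ]
      simp

theorem lDimLE_iff (k : ℕ) (hk : 1 ≤ k) (m : ℕ) (X : Type) [MetricSpace X] :
    LDimLE (↥(Metric.sphere (0 : EuclideanSpace ℝ (Fin k)) 1)) X m ↔ CovS X (k * (m + 1)) := by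
  obtain ⟨E, _, _, _, hE, ⟨φ⟩⟩ := joinPow_sphere k hk m
  rw [lDimLE_iff_nvExt φ X]
  constructor
  · intro h
    exact NVExt.covS (h.congr (by rw [hE, Module.finrank_fin_fun]))
  · intro h
    rw [← hE] at h
    exact h.nvExt

theorem ofOrdinal_lt {a b : Ordinal.{0}} : Dim.ofOrdinal a < Dim.ofOrdinal b ↔ a < b := by
  unfold Dim.ofOrdinal
  rw [WithTop.coe_lt_coe, WithBot.coe_lt_coe]

theorem dim_lt_ord {X : Type} (p : Ordinal.{0} → Prop) (n : Ordinal.{0}) :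
    (if IsEmpty X then Dim.minusOne
      else if ∃ α, p α then Dim.ofOrdinal (sInf {α | p α}) else ⊤) < Dim.ofOrdinal n ↔
    IsEmpty X ∨ ∃ α < n, p α := by
  split_ifs with h1 h2
  · simp only [h1, true_or, iff_true]
    unfold Dim.minusOne Dim.ofOrdinal
    rw [WithTop.coe_lt_coe]
    exact WithBot.bot_lt_coe _
  · rw [ofOrdinal_lt]
    simp only [h1, false_or]
    constructor
    · intro h
      exact ⟨_, h, csInf_mem (s := {α | p α}) h2⟩
    · rintro ⟨α, hα, hp⟩
      exact lt_of_le_of_lt (csInf_le' hp) hα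
  · simp only [h1, false_or, not_top_lt, false_iff]
    rintro ⟨α, -, hp⟩
    exact h2 ⟨α, hp⟩

theorem dim_lt_nat {X : Type} (p : ℕ → Prop) (n : ℕ) :
    (if IsEmpty X then Dim.minusOne
      else if ∃ α, p α then Dim.ofOrdinal ((sInf {α | p α} : ℕ) : Ordinal.{0}) else ⊤) <
      Dim.ofOrdinal (n : Ordinal.{0}) ↔ IsEmpty X ∨ ∃ α < n, p α := by
  split_ifs with h1 h2
  · simp only [h1, true_or, iff_true]
    unfold Dim.minusOne Dim.ofOrdinal
    rw [WithTop.coe_lt_coe]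
    exact WithBot.bot_lt_coe _
  · rw [ofOrdinal_lt, Nat.cast_lt]
    simp only [h1, false_or]
    constructor
    · intro h
      exact ⟨_, h, Nat.sInf_mem (s := {α | p α}) h2⟩
    · rintro ⟨α, hα, hp⟩
      exact lt_of_le_of_lt (Nat.sInf_le hp) hα
  · simp only [h1, false_or, not_top_lt, false_iff]
    rintro ⟨α, -, hp⟩
    exact h2 ⟨α, hp⟩

theorem kInd_lt_iff (k n : ℕ) (hn : 1 ≤ n) (X : Type) [MetricSpace X] :
    KInd (bComplex k) X < Dim.ofOrdinal (n : Ordinal.{0}) ↔ CovS X (k * n) := by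
  unfold KInd
  rw [dim_lt_ord]
  constructor
  · rintro (h | ⟨α, hα, h⟩)
    · exact covS_of_isEmpty _
    · obtain ⟨b, rfl⟩ := Ordinal.lt_omega0.1 (hα.trans (Ordinal.natCast_lt_omega0 n))
      have hb : b < n := by exact_mod_cast hα
      exact (KIndLE.covS b X h).mono (Nat.mul_le_mul_left _ hb)
  · intro h
    obtain ⟨m, rfl⟩ : ∃ m, n = m + 1 := ⟨n - 1, by omega⟩
    exact Or.inr ⟨m, by exact_mod_cast Nat.lt_succ_self m, CovS.kIndLE m X h⟩

theorem lDim_lt_iff (k n : ℕ) (hk : 1 ≤ k) (hn : 1 ≤ n) (X : Type) [MetricSpace X] :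
    LDim (↥(Metric.sphere (0 : EuclideanSpace ℝ (Fin k)) 1)) X < Dim.ofOrdinal (n : Ordinal.{0}) ↔
      CovS X (k * n) := by
  unfold LDim
  rw [dim_lt_nat]
  simp only [lDimLE_iff k hk]
  constructor
  · rintro (h | ⟨b, hb, h⟩)
    · exact covS_of_isEmpty _
    · exact h.mono (Nat.mul_le_mul_left _ hb)
  · intro h
    obtain ⟨m, rfl⟩ : ∃ m, n = m + 1 := ⟨n - 1, by omega⟩
    exact Or.inr ⟨m, Nat.lt_succ_self m, h⟩

theorem covDim_lt_iff (N : ℕ) (hN : 1 ≤ N) (X : Type) [TopologicalSpace X] :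
    covDim X < Dim.ofOrdinal (N : Ordinal.{0}) ↔ CovS X N := by
  unfold covDim
  rw [dim_lt_nat]
  constructor
  · rintro (h | ⟨b, hb, h⟩)
    · exact covS_of_isEmpty _
    · have h' : CovS X (b + 1) := h
      exact h'.mono hb
  · intro h
    obtain ⟨m, rfl⟩ : ∃ m, N = m + 1 := ⟨N - 1, by omega⟩
    exact Or.inr ⟨m, Nat.lt_succ_self m, h⟩

-- STATEMENT 1
theorem statement1 (k n : ℕ) (hk : 1 ≤ k) (hn : 1 ≤ n) (X : Type) [MetricSpace X] :
    (KInd (bComplex k) X < Dim.ofOrdinal (n : Ordinal.{0}) ↔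
      LDim (↥(Metric.sphere (0 : EuclideanSpace ℝ (Fin k)) 1)) X <
        Dim.ofOrdinal (n : Ordinal.{0})) ∧
    (LDim (↥(Metric.sphere (0 : EuclideanSpace ℝ (Fin k)) 1)) X <
        Dim.ofOrdinal (n : Ordinal.{0}) ↔
      covDim X < Dim.ofOrdinal ((k * n : ℕ) : Ordinal.{0})) := by
  rw [kInd_lt_iff k n hn X, lDim_lt_iff k n hk hn X,
    covDim_lt_iff (k * n) (Nat.mul_pos hk hn) X]
  exact ⟨Iff.rfl, Iff.rfl⟩

end
end

section
/- Let K be a finite simplicial complex, X a metric space, 𝒰 an open K-tuple of X, and P = X \ ⋃𝒰 the corresponding K-partition. If Ind K-obs(𝒰) < Ind P ∈ ℕ (where Ind is the large inductive dimension), then 𝒰 has a K-neighbourhood whose corresponding K-partition Q satisfies Ind Q < Ind P. -/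
open Set Topology Cardinal

noncomputable section

attribute [local instance] Classical.propDecidable

/-! ### Zero-dimensional subsets, in ambient form -/

/-- `S` has large inductive dimension at most `0` (ambient formulation). -/
def ZD {X : Type} [TopologicalSpace X] (S : Set X) : Prop :=
  ∀ G₁ G₂ : Set X, IsOpen G₁ → IsOpen G₂ → (∀ x ∈ S, x ∈ G₁ ∨ x ∈ G₂) →
    ∃ H₁ H₂ : Set X, IsOpen H₁ ∧ IsOpen H₂ ∧
      ∀ x ∈ S, (x ∈ H₁ ∧ x ∉ H₂ ∧ x ∈ G₁) ∨ (x ∈ H₂ ∧ x ∉ H₁ ∧ x ∈ G₂)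

theorem ZD_image {M X : Type} [TopologicalSpace M] [TopologicalSpace X] {e : M → X}
    (he : IsInducing e) (T : Set M) : ZD (e '' T) ↔ ZD T := by
  constructor
  · intro h G₁ G₂ h₁ h₂ hc
    obtain ⟨O₁, hO₁, rfl⟩ := he.isOpen_iff.1 h₁
    obtain ⟨O₂, hO₂, rfl⟩ := he.isOpen_iff.1 h₂
    obtain ⟨H₁, H₂, a, b, c⟩ := h O₁ O₂ hO₁ hO₂ (by
      rintro _ ⟨x, hx, rfl⟩; exact hc x hx)
    exact ⟨e ⁻¹' H₁, e ⁻¹' H₂, a.preimage he.continuous, b.preimage he.continuous,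
      fun x hx => c (e x) ⟨x, hx, rfl⟩⟩
  · intro h G₁ G₂ h₁ h₂ hc
    obtain ⟨H₁, H₂, a, b, c⟩ := h (e ⁻¹' G₁) (e ⁻¹' G₂) (h₁.preimage he.continuous)
      (h₂.preimage he.continuous) (fun x hx => hc (e x) ⟨x, hx, rfl⟩)
    obtain ⟨O₁, hO₁, rfl⟩ := he.isOpen_iff.1 a
    obtain ⟨O₂, hO₂, rfl⟩ := he.isOpen_iff.1 b
    refine ⟨O₁, O₂, hO₁, hO₂, ?_⟩
    rintro _ ⟨x, hx, rfl⟩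
    exact c x hx

theorem ZD_empty {X : Type} [TopologicalSpace X] : ZD (∅ : Set X) :=
  fun _ _ _ _ _ => ⟨∅, ∅, isOpen_empty, isOpen_empty, fun _ h => h.elim⟩

theorem ZD_inter_closed {X : Type} [TopologicalSpace X] {S F : Set X} (h : ZD S)
    (hF : IsClosed F) : ZD (S ∩ F) := by
  intro G₁ G₂ h₁ h₂ hc
  obtain ⟨H₁, H₂, a, b, c⟩ := h G₁ (G₂ ∪ Fᶜ) h₁ (h₂.union hF.isOpen_compl) (by
    intro x hx
    by_cases hxF : x ∈ F
    · rcases hc x ⟨hx, hxF⟩ with h | h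
      · exact Or.inl h
      · exact Or.inr (Or.inl h)
    · exact Or.inr (Or.inr hxF))
  refine ⟨H₁, H₂, a, b, ?_⟩
  rintro x ⟨hx, hxF⟩
  rcases c x hx with h | ⟨p, q, r | r⟩
  · exact Or.inl h
  · exact Or.inr ⟨p, q, r⟩
  · exact (r hxF).elim

/-- One step of the countable sum theorem. -/
theorem ZD_step {M : Type} [TopologicalSpace M] [NormalSpace M] {F : Set M} (hF : IsClosed F)
    (hz : ZD F) (A B : Set M) (hA : IsClosed A) (hB : IsClosed B) (hd : Disjoint A B) :
    ∃ A' B' : Set M, IsClosed A' ∧ IsClosed B' ∧ Disjoint A' B' ∧ A ⊆ interior A' ∧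
      B ⊆ interior B' ∧ F ⊆ interior A' ∪ interior B' := by
  rw [Set.disjoint_left] at hd
  obtain ⟨H₁, H₂, a, b, c⟩ := hz Bᶜ Aᶜ hB.isOpen_compl hA.isOpen_compl (by
    intro x _
    by_cases hxA : x ∈ A
    · exact Or.inl (hd hxA)
    · exact Or.inr hxA)
  have hA1 : IsClosed (A ∪ (F \ H₂)) := hA.union (hF.inter b.isClosed_compl)
  have hB1 : IsClosed (B ∪ (F \ H₁)) := hB.union (hF.inter a.isClosed_compl)
  have hd1 : A ∪ (F \ H₂) ⊆ (B ∪ (F \ H₁))ᶜ := by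
    rintro x hx hx'
    rcases hx with hx | hx <;> rcases hx' with hy | hy
    · exact hd hx hy
    · rcases c x hy.1 with h | h
      · exact hy.2 h.1
      · exact h.2.2 hx
    · rcases c x hx.1 with h | h
      · exact h.2.2 hy
      · exact hx.2 h.1
    · rcases c x hx.1 with h | h
      · exact hy.2 h.1
      · exact hx.2 h.1
  obtain ⟨O, hO, hAO, hOB⟩ := normal_exists_closure_subset hA1 hB1.isOpen_compl hd1
  obtain ⟨O', hO', hBO', hOO'⟩ := normal_exists_closure_subset hB1
    (isClosed_closure (s := O)).isOpen_compl (by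
      intro x hx hx'; exact hOB hx' hx)
  have i1 : O ⊆ interior (closure O) := interior_maximal subset_closure hO
  have i2 : O' ⊆ interior (closure O') := interior_maximal subset_closure hO'
  refine ⟨closure O, closure O', isClosed_closure, isClosed_closure, ?_, ?_, ?_, ?_⟩
  · rw [Set.disjoint_left]
    intro x hx hx'
    exact hOO' hx' hx
  · exact fun x hx => i1 (hAO (Or.inl hx))
  · exact fun x hx => i2 (hBO' (Or.inl hx))
  · intro x hx
    rcases c x hx with h | h
    · exact Or.inl (i1 (hAO (Or.inr ⟨hx, h.2.1⟩)))
    · exact Or.inr (i2 (hBO' (Or.inr ⟨hx, h.2.1⟩)))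

theorem ZD_sum_univ {M : Type} [TopologicalSpace M] [NormalSpace M] (F : ℕ → Set M)
    (hF : ∀ n, IsClosed (F n)) (hz : ∀ n, ZD (F n)) (hu : ∀ x, ∃ n, x ∈ F n) :
    ZD (Set.univ : Set M) := by
  intro G₁ G₂ h₁ h₂ hc
  let St := {p : Set M × Set M // IsClosed p.1 ∧ IsClosed p.2 ∧ Disjoint p.1 p.2}
  have step : ∀ (n : ℕ) (p : St), ∃ q : St, p.1.1 ⊆ interior q.1.1 ∧ p.1.2 ⊆ interior q.1.2 ∧
      F n ⊆ interior q.1.1 ∪ interior q.1.2 := by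
    rintro n ⟨⟨A, B⟩, hA, hB, hd⟩
    obtain ⟨A', B', a, b, c, d, e, f⟩ := ZD_step (hF n) (hz n) A B hA hB hd
    exact ⟨⟨⟨A', B'⟩, a, b, c⟩, d, e, f⟩
  choose nx hnx using step
  let p0 : St := ⟨(G₂ᶜ, G₁ᶜ), h₂.isClosed_compl, h₁.isClosed_compl, by
    rw [Set.disjoint_left]
    intro x hx hx'
    rcases hc x trivial with h | h
    · exact hx' h
    · exact hx h⟩
  let s : ℕ → St := fun n => Nat.rec p0 (fun n p => nx n p) n
  have hs : ∀ n, s (n+1) = nx n (s n) := fun n => rfl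
  have m1 : Monotone (fun n => (s n).1.1) := monotone_nat_of_le_succ (fun n => by
    rw [hs]; exact (hnx n (s n)).1.trans interior_subset)
  have m2 : Monotone (fun n => (s n).1.2) := monotone_nat_of_le_succ (fun n => by
    rw [hs]; exact (hnx n (s n)).2.1.trans interior_subset)
  have dj : ∀ i j x, x ∈ (s i).1.1 → x ∈ (s j).1.2 → False := by
    intro i j x hx hy
    have := (s (max i j)).2.2.2
    rw [Set.disjoint_left] at this
    exact this (m1 (le_max_left i j) hx) (m2 (le_max_right i j) hy)
  refine ⟨⋃ n, interior (s n).1.1, ⋃ n, interior (s n).1.2,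
    isOpen_iUnion fun _ => isOpen_interior, isOpen_iUnion fun _ => isOpen_interior, ?_⟩
  intro x _
  obtain ⟨n, hn⟩ := hu x
  have := (hnx n (s n)).2.2 hn
  rw [← hs] at this
  simp only [Set.mem_iUnion, not_exists]
  rcases this with h | h
  · refine Or.inl ⟨⟨n+1, h⟩, fun j hj => dj (n+1) j x (interior_subset h) (interior_subset hj), ?_⟩
    by_contra hx
    exact dj (n+1) 0 x (interior_subset h) hx
  · refine Or.inr ⟨⟨n+1, h⟩, fun j hj => dj j (n+1) x (interior_subset hj) (interior_subset h), ?_⟩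
    by_contra hx
    exact dj 0 (n+1) x hx (interior_subset h)

/-- Countable sum theorem for zero-dimensional sets. -/
theorem ZD_sum {X : Type} [MetricSpace X] (S : Set X) (F : ℕ → Set X)
    (hF : ∀ n, IsClosed (F n)) (hz : ∀ n, ZD (S ∩ F n)) (hu : ∀ x ∈ S, ∃ n, x ∈ F n) :
    ZD S := by
  have he : IsInducing (Subtype.val : S → X) := IsInducing.subtypeVal
  have := (ZD_image he Set.univ).2 (ZD_sum_univ (fun n => (Subtype.val : S → X) ⁻¹' F n)
    (fun n => (hF n).preimage he.continuous) (fun n => by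
      rw [← ZD_image he, Subtype.image_preimage_coe]; exact hz n)
    (fun x => hu x x.2))
  simpa using this

theorem ZD_mono {X : Type} [MetricSpace X] {S T : Set X} (h : ZD S) (hTS : T ⊆ S) : ZD T := by
  intro G₁ G₂ h₁ h₂ hc
  obtain ⟨F, hF, -, hU, -⟩ := (h₁.union h₂).exists_iUnion_isClosed
  have hz : ZD (S ∩ (G₁ ∪ G₂)) := by
    refine ZD_sum _ F hF (fun n => ?_) (fun x hx => ?_)
    · have : S ∩ (G₁ ∪ G₂) ∩ F n = S ∩ F n := by
        ext x
        constructor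
        · exact fun hx => ⟨hx.1.1, hx.2⟩
        · intro hx
          refine ⟨⟨hx.1, ?_⟩, hx.2⟩
          rw [← hU]
          exact Set.mem_iUnion.2 ⟨n, hx.2⟩
      rw [this]
      exact ZD_inter_closed h (hF n)
    · have := hx.2
      rw [← hU] at this
      exact Set.mem_iUnion.1 this
  obtain ⟨H₁, H₂, a, b, c⟩ := hz G₁ G₂ h₁ h₂ (fun x hx => hx.2)
  exact ⟨H₁, H₂, a, b, fun x hx => c x ⟨hTS hx, hc x hx⟩⟩

/-! ### Decomposition dimension -/

/-- `S` is covered by `n` zero-dimensional sets. -/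
def DD {X : Type} [TopologicalSpace X] : ℕ → Set X → Prop
  | 0, S => S = ∅
  | n + 1, S => ∃ A B : Set X, S ⊆ A ∪ B ∧ ZD A ∧ DD n B

theorem DD_mono {X : Type} [TopologicalSpace X] {n : ℕ} {S T : Set X} (h : DD n S)
    (hTS : T ⊆ S) : DD n T := by
  cases n with
  | zero =>
    have h' : S = ∅ := h
    exact Set.subset_empty_iff.1 (h' ▸ hTS)
  | succ n =>
    obtain ⟨A, B, a, b, c⟩ := h
    exact ⟨A, B, hTS.trans a, b, c⟩

theorem DD_succ {X : Type} [TopologicalSpace X] {n : ℕ} {S : Set X} (h : DD n S) :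
    DD (n+1) S := ⟨∅, S, by simp, ZD_empty, h⟩

theorem DD_le {X : Type} [TopologicalSpace X] {n k : ℕ} (hnk : n ≤ k) {S : Set X}
    (h : DD n S) : DD k S := by
  induction hnk with
  | refl => exact h
  | step _ ih => exact DD_succ ih

theorem DD_image {M X : Type} [TopologicalSpace M] [TopologicalSpace X] {e : M → X}
    (he : IsInducing e) {n : ℕ} {T : Set M} (h : DD n T) : DD n (e '' T) := by
  induction n generalizing T with
  | zero =>
    have h' : T = ∅ := h
    subst h'
    exact Set.image_empty e
  | succ n ih =>
    obtain ⟨A, B, a, b, c⟩ := h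
    refine ⟨e '' A, e '' B, ?_, (ZD_image he A).2 b, ih c⟩
    rw [← Set.image_union]
    exact Set.image_mono a

theorem DD_preimage {M X : Type} [TopologicalSpace M] [MetricSpace X] {e : M → X}
    (he : IsInducing e) {n : ℕ} {T : Set X} (h : DD n T) : DD n (e ⁻¹' T) := by
  induction n generalizing T with
  | zero =>
    have h' : T = ∅ := h
    subst h'
    exact Set.preimage_empty
  | succ n ih =>
    obtain ⟨A, B, a, b, c⟩ := h
    refine ⟨e ⁻¹' A, e ⁻¹' B, fun x hx => a hx, ?_, ih c⟩
    rw [← ZD_image he]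
    exact ZD_mono b (Set.image_preimage_subset e A)

/-- Disjointification of a sequence of closed sets into countably many closed pieces. -/
theorem closed_pieces {X : Type} [MetricSpace X] (F : ℕ → Set X) (hF : ∀ n, IsClosed (F n)) :
    ∃ T : ℕ → ℕ → Set X, (∀ i l, IsClosed (T i l)) ∧
      (∀ i j l x, x ∈ T i l → x ∈ F j → i ≤ j) ∧
      ∀ x, (∃ n, x ∈ F n) → ∃ i l, x ∈ T i l ∧ x ∈ F i := by
  have ho : ∀ i, IsOpen (⋃ j ∈ Set.Iio i, F j)ᶜ := fun i =>
    ((Set.finite_Iio i).isClosed_biUnion fun j _ => hF j).isOpen_compl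
  choose T hT _ hU _ using fun i => (ho i).exists_iUnion_isClosed
  refine ⟨T, hT, ?_, ?_⟩
  · intro i j l x hx hxj
    by_contra hlt
    have : x ∈ (⋃ j ∈ Set.Iio i, F j)ᶜ := by
      rw [← hU]; exact Set.mem_iUnion.2 ⟨l, hx⟩
    apply this
    simp only [Set.mem_iUnion]
    exact ⟨j, not_le.1 hlt, hxj⟩
  · intro x hx
    have : x ∈ (⋃ j ∈ Set.Iio (Nat.find hx), F j)ᶜ := by
      simp only [Set.mem_compl_iff, Set.mem_iUnion, not_exists]
      intro j hj hxj
      exact Nat.find_min hx hj hxj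
    rw [← hU] at this
    obtain ⟨l, hl⟩ := Set.mem_iUnion.1 this
    exact ⟨_, l, hl, Nat.find_spec hx⟩

/-- Countable closed sum theorem for the decomposition dimension. -/
theorem DD_sum {X : Type} [MetricSpace X] {n : ℕ} (S : Set X) (F : ℕ → Set X)
    (hF : ∀ n, IsClosed (F n)) (hz : ∀ i, DD n (S ∩ F i)) (hu : ∀ x ∈ S, ∃ n, x ∈ F n) :
    DD n S := by
  induction n generalizing S F with
  | zero =>
    refine Set.eq_empty_of_forall_notMem fun x hx => ?_
    obtain ⟨i, hi⟩ := hu x hx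
    have h' : S ∩ F i = ∅ := hz i
    exact (h' ▸ (⟨hx, hi⟩ : x ∈ S ∩ F i) : x ∈ (∅ : Set X))
  | succ n ih =>
    choose A B hAB hA hB using hz
    obtain ⟨T, hT, hm, hc⟩ := closed_pieces F hF
    let T' : ℕ → Set X := fun k => F k.unpair.1 ∩ T k.unpair.1 k.unpair.2
    have hT' : ∀ k, IsClosed (T' k) := fun k => (hF _).inter (hT _ _)
    have key : ∀ (C : ℕ → Set X) (k : ℕ),
        (⋃ i, ⋃ l, C i ∩ (F i ∩ T i l)) ∩ T' k ⊆ C k.unpair.1 := by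
      rintro C k x ⟨hx, hx1, hx2⟩
      simp only [Set.mem_iUnion] at hx
      obtain ⟨i, l, hxC, hxF, hxT⟩ := hx
      have e1 := hm _ _ _ x hxT hx1
      have e2 := hm _ _ _ x hx2 hxF
      rw [le_antisymm e2 e1]
      exact hxC
    have cov : ∀ (C : ℕ → Set X), ∀ x ∈ (⋃ i, ⋃ l, C i ∩ (F i ∩ T i l)), ∃ k, x ∈ T' k := by
      intro C x hx
      simp only [Set.mem_iUnion] at hx
      obtain ⟨i, l, -, h⟩ := hx
      refine ⟨Nat.pair i l, ?_⟩
      simp only [T', Nat.unpair_pair]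
      exact h
    refine ⟨⋃ i, ⋃ l, A i ∩ (F i ∩ T i l), ⋃ i, ⋃ l, B i ∩ (F i ∩ T i l), ?_, ?_, ?_⟩
    · intro x hx
      obtain ⟨i, l, h1, h2⟩ := hc x (hu x hx)
      rcases hAB i ⟨hx, h2⟩ with h | h
      · left
        simp only [Set.mem_iUnion]
        exact ⟨i, l, h, h2, h1⟩
      · right
        simp only [Set.mem_iUnion]
        exact ⟨i, l, h, h2, h1⟩
    · exact ZD_sum _ T' hT' (fun k => ZD_mono (hA _) (key A k)) (cov A)
    · exact ih _ T' hT' (fun k => DD_mono (hB _) (key B k)) (cov B)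

/-! ### From `Ind` to decompositions -/

/-- A clopen sequence criterion for zero-dimensionality of a space. -/
theorem clopen_split {M : Type} [TopologicalSpace M] (P Q : ℕ → Set M)
    (hP : ∀ n, IsClopen (P n)) (hQ : ∀ n, IsClopen (Q n))
    (hc : ∀ x, ∃ n, x ∈ P n ∨ x ∈ Q n) :
    ∃ H₁ H₂ : Set M, IsOpen H₁ ∧ IsOpen H₂ ∧ ∀ x,
      (x ∈ H₁ ∧ x ∉ H₂ ∧ ∃ n, x ∈ P n) ∨ (x ∈ H₂ ∧ x ∉ H₁ ∧ ∃ n, x ∈ Q n) := by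
  refine ⟨⋃ n, P n \ ⋃ j ∈ Set.Iio n, (P j ∪ Q j),
    ⋃ n, (Q n \ P n) \ ⋃ j ∈ Set.Iio n, (P j ∪ Q j), ?_, ?_, ?_⟩
  · exact isOpen_iUnion fun n => (hP n).isOpen.sdiff
      ((Set.finite_Iio n).isClosed_biUnion fun j _ => (hP j).isClosed.union (hQ j).isClosed)
  · exact isOpen_iUnion fun n => ((hQ n).isOpen.sdiff (hP n).isClosed).sdiff
      ((Set.finite_Iio n).isClosed_biUnion fun j _ => (hP j).isClosed.union (hQ j).isClosed)
  · intro x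
    have hs := Nat.find_spec (hc x)
    have hmin := fun j => Nat.find_min (hc x) (m := j)
    generalize Nat.find (hc x) = n at hs hmin
    simp only [Set.mem_iUnion, Set.mem_sdiff, not_exists, Set.mem_union, Set.mem_Iio, not_and]
    have uniq : ∀ k, (x ∈ P k ∨ x ∈ Q k) → (∀ j, j < k → ¬ (x ∈ P j ∨ x ∈ Q j)) → k = n := by
      intro k h1 h2
      rcases lt_trichotomy k n with h | h | h
      · exact (hmin k h h1).elim
      · exact h
      · exact (h2 n h hs).elim
    by_cases hxP : x ∈ P n
    · left
      refine ⟨⟨n, hxP, fun j hj => hmin j hj⟩, ?_, n, hxP⟩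
      intro k hk hall
      have := uniq k (Or.inr hk.1) (fun j hj => hall j hj)
      subst this
      exact hk.2 hxP
    · right
      have hxQ : x ∈ Q n := hs.resolve_left hxP
      refine ⟨⟨n, ⟨hxQ, hxP⟩, fun j hj => hmin j hj⟩, ?_, n, hxQ⟩
      intro k hk hall
      have := uniq k (Or.inl hk) (fun j hj => hall j hj)
      subst this
      exact hxP hk

/-- Every metric space has, for each `ε`, a σ-disjoint open cover by subsets of `ε`-balls. -/
theorem sigma_disjoint {X : Type} [MetricSpace X] (ε : ℝ) (hε : 0 < ε) :
    ∃ W : ℕ → X → Set X, (∀ i s, IsOpen (W i s)) ∧ (∀ i s, W i s ⊆ Metric.ball s ε) ∧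
      (∀ i s t x, x ∈ W i s → x ∈ W i t → s = t) ∧ ∀ x, ∃ i s, x ∈ W i s := by
  obtain ⟨r, wo⟩ := exists_wellOrder X
  let δ : ℕ → ℝ := fun i => 1 / ((i : ℝ) + 1)
  have hδ : ∀ i, 0 < δ i := fun i => by positivity
  let C : ℕ → X → Set X := fun i s => {x | (∀ t, t < s → x ∉ Metric.ball t ε) ∧
    Metric.ball x (3 * δ i) ⊆ Metric.ball s ε}
  refine ⟨fun i s => ⋃ x ∈ C i s, Metric.ball x (δ i), ?_, ?_, ?_, ?_⟩
  · exact fun i s => isOpen_biUnion fun x _ => Metric.isOpen_ball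
  · intro i s
    refine Set.iUnion₂_subset fun x hx => (Metric.ball_subset_ball ?_).trans hx.2
    linarith [hδ i]
  · have main : ∀ i s t z, s < t → z ∈ (⋃ x ∈ C i s, Metric.ball x (δ i)) →
        z ∈ (⋃ x ∈ C i t, Metric.ball x (δ i)) → False := by
      intro i s t z hst hz hz'
      simp only [Set.mem_iUnion, Metric.mem_ball] at hz hz'
      obtain ⟨x, hx, hzx⟩ := hz
      obtain ⟨y, hy, hzy⟩ := hz'
      apply hy.1 s hst
      apply hx.2
      rw [Metric.mem_ball]
      have := dist_triangle y z x
      rw [dist_comm y z] at this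
      linarith [hδ i]
    intro i s t z hz hz'
    rcases lt_trichotomy s t with h | h | h
    · exact (main i s t z h hz hz').elim
    · exact h
    · exact (main i t s z h hz' hz).elim
  · intro x
    have hne : {s : X | x ∈ Metric.ball s ε}.Nonempty := ⟨x, Metric.mem_ball_self hε⟩
    let s := (wellFounded_lt (α := X)).min {s : X | x ∈ Metric.ball s ε} hne
    have hs : x ∈ Metric.ball s ε := (wellFounded_lt (α := X)).min_mem _ hne
    have hlt : ∀ t, t < s → x ∉ Metric.ball t ε := fun t ht hx =>
      (wellFounded_lt (α := X)).not_lt_min {s : X | x ∈ Metric.ball s ε} hx ht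
    obtain ⟨η, hη, hb⟩ := Metric.isOpen_iff.1 Metric.isOpen_ball x hs
    obtain ⟨i, hi⟩ := exists_nat_one_div_lt (show 0 < η / 3 by positivity)
    refine ⟨i, s, ?_⟩
    simp only [Set.mem_iUnion]
    refine ⟨x, ⟨hlt, (Metric.ball_subset_ball ?_).trans hb⟩, Metric.mem_ball_self (hδ i)⟩
    have : δ i < η / 3 := hi
    linarith

theorem DD_of_sep {X : Type} [MetricSpace X] (n : ℕ)
    (h : ∀ F U : Set X, IsClosed F → IsOpen U → F ⊆ U →
      ∃ V : Set X, IsOpen V ∧ F ⊆ V ∧ V ⊆ U ∧ DD n (frontier V)) :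
    DD (n+1) (Set.univ : Set X) := by
  have hε : ∀ k : ℕ, 0 < 1 / ((k : ℝ) + 1) := fun k => by positivity
  choose W hWo hWb hWd hWc using fun k : ℕ => sigma_disjoint (X := X) (1 / ((k : ℝ) + 1)) (hε k)
  have hO : ∀ k i, IsOpen (⋃ s, W k i s) := fun k i => isOpen_iUnion fun s => hWo k i s
  choose F hF _ hFU _ using fun k i => (hO k i).exists_iUnion_isClosed
  have hsub : ∀ k i l, F k i l ⊆ ⋃ s, W k i s := fun k i l => by
    rw [← hFU]; exact Set.subset_iUnion _ l
  choose V hVo hFV hVU hVD using fun k i l => h (F k i l) (⋃ s, W k i s) (hF k i l) (hO k i)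
    (hsub k i l)
  -- reindex by a single natural number
  let a : ℕ → ℕ := fun q => q.unpair.1
  let b : ℕ → ℕ := fun q => q.unpair.2.unpair.1
  let c : ℕ → ℕ := fun q => q.unpair.2.unpair.2
  let V' : ℕ → Set X := fun q => V (a q) (b q) (c q)
  let T : Set X := ⋃ q, frontier (V' q)
  have hTD : DD n T := by
    refine DD_sum T (fun q => frontier (V' q)) (fun q => isClosed_frontier) (fun q => ?_) ?_
    · exact DD_mono (hVD (a q) (b q) (c q)) Set.inter_subset_right
    · intro x hx
      exact Set.mem_iUnion.1 hx
  refine ⟨Tᶜ, T, by simp, ?_, hTD⟩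
  intro G₁ G₂ h₁ h₂ hc
  have he : IsInducing (Subtype.val : (Tᶜ : Set X) → X) := IsInducing.subtypeVal
  have hclop : ∀ (q : ℕ) (J : Set X), IsClopen ((Subtype.val : (Tᶜ : Set X) → X) ⁻¹'
      (V' q ∩ ⋃ s ∈ J, W (a q) (b q) s)) := by
    intro q J
    have ho : ∀ J : Set X, IsOpen (V' q ∩ ⋃ s ∈ J, W (a q) (b q) s) := fun J =>
      (hVo _ _ _).inter (isOpen_biUnion fun s _ => hWo _ _ s)
    refine ⟨?_, (ho J).preimage he.continuous⟩
    rw [← isOpen_compl_iff]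
    have : ((Subtype.val : (Tᶜ : Set X) → X) ⁻¹' (V' q ∩ ⋃ s ∈ J, W (a q) (b q) s))ᶜ =
        (Subtype.val : (Tᶜ : Set X) → X) ⁻¹'
          ((closure (V' q))ᶜ ∪ (V' q ∩ ⋃ s ∈ Jᶜ, W (a q) (b q) s)) := by
      ext ⟨x, hx⟩
      simp only [Set.mem_compl_iff, Set.mem_preimage, Set.mem_union, Set.mem_inter_iff]
      constructor
      · intro hn
        by_cases hxV : x ∈ V' q
        · right
          refine ⟨hxV, ?_⟩
          obtain ⟨s, hs⟩ := Set.mem_iUnion.1 (hVU _ _ _ hxV)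
          simp only [Set.mem_iUnion]
          refine ⟨s, fun hsJ => hn ⟨hxV, ?_⟩, hs⟩
          simp only [Set.mem_iUnion]
          exact ⟨s, hsJ, hs⟩
        · left
          intro hcl
          apply hx
          refine Set.mem_iUnion.2 ⟨q, hcl, ?_⟩
          rw [(hVo _ _ _).interior_eq]
          exact hxV
      · rintro (hn | hn) hh
        · exact hn (subset_closure hh.1)
        · obtain ⟨-, h1⟩ := hn
          obtain ⟨-, h2⟩ := hh
          simp only [Set.mem_iUnion] at h1 h2
          obtain ⟨s, hs, hxs⟩ := h1
          obtain ⟨t, ht, hxt⟩ := h2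
          have := hWd _ _ _ _ x hxs hxt
          subst this
          exact hs ht
    rw [this]
    exact (isClosed_closure.isOpen_compl.union (ho _)).preimage he.continuous
  let J : Set X → ℕ → Set X := fun G q => {s | W (a q) (b q) s ⊆ G}
  have hJ : ∀ G q x, x ∈ (⋃ s ∈ J G q, W (a q) (b q) s) → x ∈ G := by
    intro G q x hx
    simp only [Set.mem_iUnion] at hx
    obtain ⟨s, hs, hxs⟩ := hx
    exact hs hxs
  have hcov : ∀ G : Set X, IsOpen G → ∀ x ∈ G, ∃ q,
      x ∈ V' q ∩ ⋃ s ∈ J G q, W (a q) (b q) s := by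
    intro G hG x hx
    obtain ⟨η, hη, hball⟩ := Metric.isOpen_iff.1 hG x hx
    obtain ⟨k, hk⟩ := exists_nat_one_div_lt (show 0 < η / 2 by positivity)
    obtain ⟨i, s, hs⟩ := hWc k x
    have hx' : x ∈ ⋃ l, F k i l := by
      rw [hFU]; exact Set.mem_iUnion.2 ⟨s, hs⟩
    obtain ⟨l, hl⟩ := Set.mem_iUnion.1 hx'
    refine ⟨Nat.pair k (Nat.pair i l), ?_⟩
    simp only [V', J, a, b, c, Nat.unpair_pair]
    refine ⟨hFV k i l hl, ?_⟩
    simp only [Set.mem_iUnion]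
    refine ⟨s, ?_, hs⟩
    intro y hy
    apply hball
    have d1 := hWb k i s hy
    have d2 := hWb k i s hs
    rw [Metric.mem_ball] at d1 d2 ⊢
    have := dist_triangle y s x
    rw [dist_comm s x] at this
    linarith
  obtain ⟨H₁, H₂, o₁, o₂, hH⟩ := clopen_split
    (fun q => (Subtype.val : (Tᶜ : Set X) → X) ⁻¹' (V' q ∩ ⋃ s ∈ J G₁ q, W (a q) (b q) s))
    (fun q => (Subtype.val : (Tᶜ : Set X) → X) ⁻¹' (V' q ∩ ⋃ s ∈ J G₂ q, W (a q) (b q) s))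
    (fun q => hclop q _) (fun q => hclop q _) (by
      rintro ⟨x, hx⟩
      rcases hc x hx with hg | hg
      · obtain ⟨q, hq⟩ := hcov G₁ h₁ x hg
        exact ⟨q, Or.inl hq⟩
      · obtain ⟨q, hq⟩ := hcov G₂ h₂ x hg
        exact ⟨q, Or.inr hq⟩)
  obtain ⟨O₁, hO₁, rfl⟩ := he.isOpen_iff.1 o₁
  obtain ⟨O₂, hO₂, rfl⟩ := he.isOpen_iff.1 o₂
  refine ⟨O₁, O₂, hO₁, hO₂, ?_⟩
  intro x hx
  rcases hH ⟨x, hx⟩ with ⟨p1, p2, q, hq⟩ | ⟨p1, p2, q, hq⟩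
  · exact Or.inl ⟨p1, p2, hJ _ _ _ hq.2⟩
  · exact Or.inr ⟨p1, p2, hJ _ _ _ hq.2⟩

theorem DD_of_subtype {X : Type} [TopologicalSpace X] {n : ℕ} {S : Set X}
    (h : DD n (Set.univ : Set S)) : DD n S := by
  have := DD_image (IsInducing.subtypeVal (t := S)) h
  simpa using this

theorem DD_to_subtype {X : Type} [MetricSpace X] {n : ℕ} {S : Set X}
    (h : DD n S) : DD n (Set.univ : Set S) := by
  have := DD_preimage (IsInducing.subtypeVal (t := S)) h
  simpa using this

theorem DD_of_IndLE (n : ℕ) : ∀ (X : Type) [MetricSpace X], IndLE n X inferInstance →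
    DD (n+1) (Set.univ : Set X) := by
  induction n with
  | zero =>
    intro X _ h
    apply DD_of_sep
    intro F U hF hU hFU
    obtain ⟨V, a, b, c, d⟩ := h F U hF hU hFU
    exact ⟨V, a, b, c, d⟩
  | succ n ih =>
    intro X _ h
    apply DD_of_sep
    intro F U hF hU hFU
    obtain ⟨V, a, b, c, d⟩ := h F U hF hU hFU
    exact ⟨V, a, b, c, DD_of_subtype (ih _ d)⟩

/-! ### From decompositions to `Ind` -/

theorem sep_avoid {X : Type} [MetricSpace X] {A : Set X} (hA : ZD A) (F U : Set X)
    (hF : IsClosed F) (hU : IsOpen U) (hFU : F ⊆ U) :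
    ∃ V : Set X, IsOpen V ∧ F ⊆ V ∧ V ⊆ U ∧ ∀ x ∈ frontier V, x ∉ A := by
  obtain ⟨O₁, hO₁, hFO₁, hO₁U⟩ := normal_exists_closure_subset hF hU hFU
  obtain ⟨O₂, hO₂, hO₁₂, hO₂U⟩ := normal_exists_closure_subset isClosed_closure hU hO₁U
  obtain ⟨H₁, H₂, h₁, h₂, hH⟩ := hA O₂ (closure O₁)ᶜ hO₂ isClosed_closure.isOpen_compl (by
    intro x _
    by_cases hx : x ∈ closure O₁
    · exact Or.inl (hO₁₂ hx)
    · exact Or.inr hx)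
  have cu : closure Uᶜ = Uᶜ := hU.isClosed_compl.closure_eq
  have cf : closure F = F := hF.closure_eq
  -- closure facts
  have k1 : ∀ x ∈ closure (A \ H₁), x ∉ H₁ := by
    intro x hx hx1
    obtain ⟨y, hy, hy'⟩ := mem_closure_iff.1 hx H₁ h₁ hx1
    exact hy'.2 hy
  have k2 : ∀ x ∈ closure (A \ H₂), x ∉ H₂ := by
    intro x hx hx1
    obtain ⟨y, hy, hy'⟩ := mem_closure_iff.1 hx H₂ h₂ hx1
    exact hy'.2 hy
  have s1 : A \ H₂ ⊆ O₂ := by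
    intro x hx
    rcases hH x hx.1 with h | h
    · exact h.2.2
    · exact (hx.2 h.1).elim
  have s1' : A \ H₂ ⊆ H₁ := by
    intro x hx
    rcases hH x hx.1 with h | h
    · exact h.1
    · exact (hx.2 h.1).elim
  have s2 : A \ H₁ ⊆ (closure O₁)ᶜ := by
    intro x hx
    rcases hH x hx.1 with h | h
    · exact (hx.2 h.1).elim
    · exact h.2.2
  have s2' : A \ H₁ ⊆ H₂ := by
    intro x hx
    rcases hH x hx.1 with h | h
    · exact (hx.2 h.1).elim
    · exact h.1
  have k3 : ∀ x ∈ closure (A \ H₁), x ∉ F := by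
    intro x hx hxF
    obtain ⟨y, hy, hy'⟩ := mem_closure_iff.1 hx O₁ hO₁ (hFO₁ hxF)
    exact s2 hy' (subset_closure hy)
  have d1 : Disjoint (closure (F ∪ (A \ H₂))) (Uᶜ ∪ (A \ H₁)) := by
    rw [Set.disjoint_left, closure_union, cf]
    rintro x (hx | hx) (hy | hy)
    · exact hy (hFU hx)
    · exact k3 x (subset_closure hy) hx
    · exact hy (hO₂U (closure_mono s1 hx))
    · exact k2 x hx (s2' hy)
  have d2 : Disjoint (F ∪ (A \ H₂)) (closure (Uᶜ ∪ (A \ H₁))) := by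
    rw [Set.disjoint_left, closure_union, cu]
    rintro x (hx | hx) (hy | hy)
    · exact hy (hFU hx)
    · exact k3 x hy hx
    · exact hy (hO₂U (subset_closure (s1 hx)))
    · exact k1 x hy (s1' hx)
  obtain ⟨V, V', hV, hV', hFV, hUV', hd⟩ :=
    (separatedNhds_iff_disjoint.2 (completely_normal d1 d2) : SeparatedNhds _ _)
  rw [Set.disjoint_left] at hd
  refine ⟨V, hV, fun x hx => hFV (Or.inl hx), ?_, ?_⟩
  · intro x hx
    by_contra hxU
    exact hd hx (hUV' (Or.inl hxU))
  · intro x hx hxA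
    rw [hV.frontier_eq] at hx
    by_cases h2 : x ∈ H₂
    · have h1 : x ∉ H₁ := by
        rcases hH x hxA with h | h
        · exact (h.2.1 h2).elim
        · exact h.2.1
      obtain ⟨y, hy, hy'⟩ := mem_closure_iff.1 hx.1 V' hV' (hUV' (Or.inr ⟨hxA, h1⟩))
      exact hd hy' hy
    · exact hx.2 (hFV (Or.inr ⟨hxA, h2⟩))

theorem IndLE_of_DD (n : ℕ) : ∀ (X : Type) [MetricSpace X], DD (n+1) (Set.univ : Set X) →
    IndLE n X inferInstance := by
  induction n with
  | zero =>
    rintro X _ ⟨A, B, hAB, hA, hB⟩ F U hF hU hFU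
    obtain ⟨V, a, b, c, d⟩ := sep_avoid hA F U hF hU hFU
    refine ⟨V, a, b, c, Set.eq_empty_of_forall_notMem fun x hx => ?_⟩
    have hB' : B = ∅ := hB
    rw [hB', Set.union_empty] at hAB
    exact d x hx (hAB trivial)
  | succ n ih =>
    rintro X _ ⟨A, B, hAB, hA, hB⟩ F U hF hU hFU
    obtain ⟨V, a, b, c, d⟩ := sep_avoid hA F U hF hU hFU
    refine ⟨V, a, b, c, ih _ (DD_to_subtype (DD_mono hB ?_))⟩
    intro x hx
    exact (hAB (trivial : x ∈ Set.univ)).resolve_left (d x hx)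

/-! ### Disjoint refinements of finite covers of zero-dimensional sets -/

theorem ZD_finite_cover {X ι : Type} [MetricSpace X] (W : ι → Set X) (hW : ∀ i, IsOpen (W i))
    (s : Finset ι) : ∀ S : Set X, ZD S → (∀ x ∈ S, ∃ i ∈ s, x ∈ W i) →
    ∃ H : ι → Set X, (∀ i, IsOpen (H i)) ∧ (∀ x ∈ S, ∃ i ∈ s, x ∈ H i ∧ x ∈ W i) ∧
      ∀ x ∈ S, ∀ i j, x ∈ H i → x ∈ H j → i = j := by
  induction s using Finset.induction_on with
  | empty =>
    intro S _ hc
    refine ⟨fun _ => ∅, fun _ => isOpen_empty, fun x hx => ?_, fun x hx i j h => h.elim⟩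
    obtain ⟨i, hi, -⟩ := hc x hx
    simp at hi
  | insert a s ha ih =>
    intro S hS hc
    obtain ⟨H₁, H₂, h₁, h₂, hH⟩ := hS (W a) (⋃ i ∈ s, W i) (hW a)
      (isOpen_biUnion fun i _ => hW i) (by
        intro x hx
        obtain ⟨i, hi, hxi⟩ := hc x hx
        rcases Finset.mem_insert.1 hi with h | h
        · exact Or.inl (h ▸ hxi)
        · right
          simp only [Set.mem_iUnion]
          exact ⟨i, h, hxi⟩)
    obtain ⟨H, hHo, hHc, hHd⟩ := ih (S ∩ H₂) (ZD_mono hS Set.inter_subset_left) (by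
      rintro x ⟨hx, hx2⟩
      rcases hH x hx with h | h
      · exact (h.2.1 hx2).elim
      · have := h.2.2
        simp only [Set.mem_iUnion] at this
        obtain ⟨i, hi, hxi⟩ := this
        exact ⟨i, hi, hxi⟩)
    refine ⟨fun i => if i = a then H₁ else H i ∩ H₂, ?_, ?_, ?_⟩
    · intro i
      by_cases hi : i = a
      · simpa [hi] using h₁
      · simpa [hi] using (hHo i).inter h₂
    · intro x hx
      rcases hH x hx with h | h
      · exact ⟨a, Finset.mem_insert_self a s, by simpa using h.1, h.2.2⟩
      · obtain ⟨i, hi, h1, h2⟩ := hHc x ⟨hx, h.1⟩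
        have hia : i ≠ a := fun e => ha (e ▸ hi)
        refine ⟨i, Finset.mem_insert_of_mem hi, ?_, h2⟩
        simp only [hia, if_false]
        exact ⟨h1, h.1⟩
    · intro x hx i j hi hj
      by_cases hia : i = a <;> by_cases hja : j = a
      · rw [hia, hja]
      · simp only [hia, hja, if_true, if_false] at hi hj
        rcases hH x hx with h | h
        · exact (h.2.1 hj.2).elim
        · exact (h.2.1 hi).elim
      · simp only [hia, hja, if_true, if_false] at hi hj
        rcases hH x hx with h | h
        · exact (h.2.1 hi.2).elim
        · exact (h.2.1 hj).elim
      · simp only [hia, hja, if_false] at hi hj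
        exact hHd x ⟨hx, hi.2⟩ i j hi.1 hj.1

theorem ZD_disjoint_cover {X ι : Type} [Fintype ι] [MetricSpace X] (W : ι → Set X)
    (hW : ∀ i, IsOpen (W i)) (S : Set X) (hS : ZD S) (hc : ∀ x ∈ S, ∃ i, x ∈ W i) :
    ∃ G : ι → Set X, (∀ i, IsOpen (G i)) ∧ (∀ i, G i ⊆ W i) ∧ (∀ x ∈ S, ∃ i, x ∈ G i) ∧
      ∀ x i j, x ∈ G i → x ∈ G j → i = j := by
  obtain ⟨H, hHo, hHc, hHd⟩ := ZD_finite_cover W hW Finset.univ S hS (by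
    intro x hx
    obtain ⟨i, hi⟩ := hc x hx
    exact ⟨i, Finset.mem_univ i, hi⟩)
  let R : ι → Set X := fun i => ⋃ j ∈ ({i}ᶜ : Set ι), S ∩ H j
  have hR : ∀ i j, i ≠ j → S ∩ H j ⊆ R i := fun i j hij x hx => by
    simp only [R, Set.mem_iUnion]
    exact ⟨j, fun e => hij e.symm, hx⟩
  refine ⟨fun i => {z | Metric.infEDist z (S ∩ H i) < Metric.infEDist z (R i)} ∩ W i,
    ?_, fun i => Set.inter_subset_right, ?_, ?_⟩
  · exact fun i => (isOpen_lt Metric.continuous_infEDist Metric.continuous_infEDist).inter (hW i)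
  · intro x hx
    obtain ⟨i, -, hi, hw⟩ := hHc x hx
    refine ⟨i, ?_, hw⟩
    change Metric.infEDist x (S ∩ H i) < Metric.infEDist x (R i)
    rw [Metric.infEDist_zero_of_mem (show x ∈ S ∩ H i from ⟨hx, hi⟩)]
    rw [pos_iff_ne_zero]
    intro h0
    rw [← Metric.mem_closure_iff_infEDist_zero] at h0
    obtain ⟨y, hy, hy'⟩ := mem_closure_iff.1 h0 (H i) (hHo i) hi
    simp only [R, Set.mem_iUnion] at hy'
    obtain ⟨j, hj, hyS, hyj⟩ := hy'
    exact hj (hHd y hyS j i hyj hy)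
  · rintro x i j ⟨hi, -⟩ ⟨hj, -⟩
    by_contra hij
    rw [Set.mem_ofPred_eq] at hi hj
    have e1 := Metric.infEDist_anti (x := x) (hR i j hij)
    have e2 := Metric.infEDist_anti (x := x) (hR j i (Ne.symm hij))
    exact lt_irrefl _ ((hi.trans_le e1).trans (hj.trans_le e2))

/-! ### `IndDim` versus decompositions -/

theorem DD_of_IndDim_lt {X : Type} [MetricSpace X] {p : ℕ}
    (h : IndDim X < Dim.ofOrdinal ((p : ℕ) : Ordinal.{0})) : DD p (Set.univ : Set X) := by
  unfold IndDim at h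
  split_ifs at h with h1 h2
  · refine DD_le (Nat.zero_le p) ?_
    exact Set.univ_eq_empty_iff.2 h1
  · have hm : IndLE (sInf {n | IndLE n X inferInstance}) X inferInstance := Nat.sInf_mem h2
    have hlt : sInf {n | IndLE n X inferInstance} < p := by
      simpa [Dim.ofOrdinal] using h
    exact DD_le hlt (DD_of_IndLE _ X hm)
  · exact (not_top_lt h).elim

theorem IndDim_lt_of_DD {X : Type} [MetricSpace X] {p : ℕ} (h : DD p (Set.univ : Set X)) :
    IndDim X < Dim.ofOrdinal ((p : ℕ) : Ordinal.{0}) := by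
  unfold IndDim
  split_ifs with h1 h2
  · unfold Dim.minusOne Dim.ofOrdinal
    rw [WithTop.coe_lt_coe]
    exact WithBot.bot_lt_coe _
  · cases p with
    | zero => exact (h1 (Set.univ_eq_empty_iff.1 h)).elim
    | succ q =>
      have hm : IndLE q X inferInstance := IndLE_of_DD q X h
      have hlt : sInf {n | IndLE n X inferInstance} < q + 1 :=
        Nat.lt_succ_of_le (Nat.sInf_le hm)
      have : ((sInf {n | IndLE n X inferInstance} : ℕ) : Ordinal.{0}) < ((q + 1 : ℕ) : Ordinal.{0}) :=
        Nat.cast_lt.2 hlt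
      unfold Dim.ofOrdinal
      rw [WithTop.coe_lt_coe, WithBot.coe_lt_coe]
      exact this
  · cases p with
    | zero => exact (h1 (Set.univ_eq_empty_iff.1 h)).elim
    | succ q => exact (h2 ⟨q, IndLE_of_DD q X h⟩).elim


-- STATEMENT 6
theorem statement6 (m : ℕ) (K : Finset (Fin m) → Prop) (hK : IsComplex K)
    (X : Type) [MetricSpace X]
    (U : Fin m → Set X) (hU : ∀ i, IsOpen (U i)) (ht : IsKTuple K U)
    (p : ℕ) (hP : IndDim (↥((⋃ i, U i)ᶜ)) = Dim.ofOrdinal ((p : ℕ) : Ordinal.{0}))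
    (hobs : IndDim (↥(KObs K U)) < IndDim (↥((⋃ i, U i)ᶜ))) :
    ∃ V : Fin m → Set X, KNbhd K U V ∧
      IndDim (↥((⋃ i, V i)ᶜ)) < IndDim (↥((⋃ i, U i)ᶜ)) := by
  have hP' : DD (p+1) (⋃ i, U i)ᶜ := by
    apply DD_of_subtype
    apply DD_of_IndDim_lt
    rw [hP]
    unfold Dim.ofOrdinal
    rw [WithTop.coe_lt_coe, WithBot.coe_lt_coe]
    exact Nat.cast_lt.2 (Nat.lt_succ_self p)
  rw [hP] at hobs ⊢
  have hO : DD p (KObs K U) := DD_of_subtype (DD_of_IndDim_lt hobs)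
  let W : Fin m → Set X := fun j => ⋃ V ∈ {V : Fin m → Set X | KNbhd K U V}, V j
  have hWo : ∀ j, IsOpen (W j) := fun j => isOpen_biUnion fun V hV => hV.1 j
  have hW : ∀ x, x ∉ KObs K U → ∃ j, x ∈ W j := by
    intro x hx
    simp only [KObs, Set.mem_ofPred_eq, not_not] at hx
    obtain ⟨V, hV, hxV⟩ := hx
    obtain ⟨j, hj⟩ := Set.mem_iUnion.1 hxV
    refine ⟨j, ?_⟩
    simp only [W, Set.mem_iUnion]
    exact ⟨V, hV, hj⟩
  have hOc : IsOpen (KObs K U)ᶜ := by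
    have : (KObs K U)ᶜ = ⋃ j, W j := by
      ext x
      constructor
      · exact fun hx => Set.mem_iUnion.2 (hW x hx)
      · intro hx hx'
        simp only [W, Set.mem_iUnion] at hx
        obtain ⟨j, V, hV, hxj⟩ := hx
        exact hx' ⟨V, hV, Set.mem_iUnion.2 ⟨j, hxj⟩⟩
    rw [this]
    exact isOpen_iUnion hWo
  obtain ⟨A, B, hAB, hA, hB⟩ := hP'
  obtain ⟨G, hGo, hGW, hGc, hGd⟩ := ZD_disjoint_cover W hWo (A \ KObs K U)
    (ZD_mono hA Set.sdiff_subset) (fun x hx => hW x hx.2)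
  refine ⟨fun i => U i ∪ G i, ⟨fun i => (hU i).union (hGo i), ?_, fun i =>
    Set.subset_union_left⟩, ?_⟩
  · rintro I hI ⟨y, hy⟩
    simp only [Set.mem_iInter] at hy
    by_cases hyG : ∃ j, y ∈ G j
    · obtain ⟨j, hj⟩ := hyG
      have := hGW j hj
      simp only [W, Set.mem_iUnion] at this
      obtain ⟨V, hV, hyV⟩ := this
      refine hV.2.1 I hI ⟨y, ?_⟩
      simp only [Set.mem_iInter]
      intro i hi
      rcases hy i hi with h | h
      · exact hV.2.2 i h
      · rw [hGd y i j h hj]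
        exact hyV
    · refine ht I hI ⟨y, ?_⟩
      simp only [Set.mem_iInter]
      exact fun i hi => (hy i hi).resolve_right fun h => hyG ⟨i, h⟩
  · apply IndDim_lt_of_DD
    apply DD_to_subtype
    obtain ⟨F, hF, -, hFU, -⟩ := hOc.exists_iUnion_isClosed
    refine DD_sum _ (fun n => Nat.casesOn n (KObs K U) F) ?_ ?_ ?_
    · rintro (_ | n)
      · exact isOpen_compl_iff.1 hOc
      · exact hF n
    · rintro (_ | n)
      · exact DD_mono hO Set.inter_subset_right
      · refine DD_mono hB ?_
        rintro x ⟨hx, hxF⟩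
        have hxO : x ∈ (KObs K U)ᶜ := by
          rw [← hFU]; exact Set.mem_iUnion.2 ⟨n, hxF⟩
        have hxP : x ∈ (⋃ i, U i)ᶜ := by
          intro h
          obtain ⟨i, hi⟩ := Set.mem_iUnion.1 h
          exact hx (Set.mem_iUnion.2 ⟨i, Or.inl hi⟩)
        refine (hAB hxP).resolve_left fun hxA => ?_
        obtain ⟨i, hi⟩ := hGc x ⟨hxA, hxO⟩
        exact hx (Set.mem_iUnion.2 ⟨i, Or.inr hi⟩)
    · intro x _
      by_cases hx : x ∈ KObs K U
      · exact ⟨0, hx⟩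
      · have : x ∈ ⋃ n, F n := by rw [hFU]; exact hx
        obtain ⟨n, hn⟩ := Set.mem_iUnion.1 this
        exact ⟨n+1, hn⟩

end
end
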